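/- arXiv:1206.0867 — 2 statements merged into one kernel-verified Lean document; each statement's English description precedes it below -/
import Mathlib

section
/- For each index n, let Ξ be a p × q₁ random matrix and H be a p × (n−q) random matrix whose entries are all i.i.d. real standard normal N(0,1) random variables (Ξ and H independent), and set S₁ = (1/q₁)·Ξ Ξᵀ and S₂ = (1/(n−q))·H Hᵀ. On the almost sure event that S₂ is invertible, define L_n = log det(I_p + (q₁/(n−q))·S₁S₂^{−1}) (and define L_n = 0 otherwise). Suppose that as n → ∞: p → ∞, q₁ → ∞, n − q → ∞, y_{n₁} = p/q₁ → y₁ ∈ (0,1) and y_{n₂} = p/(n−q) → y₂ ∈ (0,1). Then L_n − p·F_n converges in distribution to the Gaussian law N(m, v), where m = (1/2)·log((c²−d²)h²/(ch − y₂d)²) and v = 2·log(c²/(c²−d²)) are computed from y₁, y₂ via h = √(y₁+y₂−y₁y₂), a₀ = (1−h)²/(1−y₂)², b₀ = (1+h)²/(1−y₂)², c = (1/2)(√(1+(y₂/y₁)b₀)+√(1+(y₂/y₁)a₀)), d = (1/2)(√(1+(y₂/y₁)b₀)−√(1+(y₂/y₁)a₀)); and F_n = ((y_{n₂}−1)/y_{n₂})·log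 c_n + ((y_{n₁}−1)/y_{n₁})·log(c_n − d_n h_n) + ((y_{n₁}+y_{n₂})/(y_{n₁}y_{n₂}))·log((c_n h_n − d_n y_{n₂})/h_n), computed from the finite-n ratios via h_n = √(y_{n₁}+y_{n₂}−y_{n₁}y_{n₂}), a_n = (1−h_n)²/(1−y_{n₂})², b_n = (1+h_n)²/(1−y_{n₂})², c_n = (1/2)(√(1+(y_{n₂}/y_{n₁})b_n)+√(1+(y_{n₂}/y_{n₁})a_n)), d_n = (1/2)(√(1+(y_{n₂}/y_{n₁})b_n)−√(1+(y_{n₂}/y_{n₁})a_n)). -/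
open Real Filter MeasureTheory ProbabilityTheory Matrix
open scoped Classical

noncomputable def fisherH (u₁ u₂ : ℝ) : ℝ := Real.sqrt (u₁ + u₂ - u₁ * u₂)
noncomputable def fisherA (u₁ u₂ : ℝ) : ℝ := (1 - fisherH u₁ u₂) ^ 2 / (1 - u₂) ^ 2
noncomputable def fisherB (u₁ u₂ : ℝ) : ℝ := (1 + fisherH u₁ u₂) ^ 2 / (1 - u₂) ^ 2
/-- `c = (1/2)(√(1+(u₂/u₁)b₀)+√(1+(u₂/u₁)a₀))`. -/
noncomputable def fisherC (u₁ u₂ : ℝ) : ℝ :=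
  (1 / 2) * (Real.sqrt (1 + (u₂ / u₁) * fisherB u₁ u₂) + Real.sqrt (1 + (u₂ / u₁) * fisherA u₁ u₂))
/-- `d = (1/2)(√(1+(u₂/u₁)b₀)−√(1+(u₂/u₁)a₀))`. -/
noncomputable def fisherD (u₁ u₂ : ℝ) : ℝ :=
  (1 / 2) * (Real.sqrt (1 + (u₂ / u₁) * fisherB u₁ u₂) - Real.sqrt (1 + (u₂ / u₁) * fisherA u₁ u₂))
/-- `m = (1/2)·log((c²−d²)h²/(ch−u₂d)²)`. -/
noncomputable def wilksMean (u₁ u₂ : ℝ) : ℝ :=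
  (1 / 2) * Real.log ((fisherC u₁ u₂ ^ 2 - fisherD u₁ u₂ ^ 2) * fisherH u₁ u₂ ^ 2 /
      (fisherC u₁ u₂ * fisherH u₁ u₂ - u₂ * fisherD u₁ u₂) ^ 2)
/-- `v = 2·log(c²/(c²−d²))`. -/
noncomputable def wilksVar (u₁ u₂ : ℝ) : ℝ :=
  2 * Real.log (fisherC u₁ u₂ ^ 2 / (fisherC u₁ u₂ ^ 2 - fisherD u₁ u₂ ^ 2))
/-- `F = ((u₂−1)/u₂)·log c + ((u₁−1)/u₁)·log(c−dh) + ((u₁+u₂)/(u₁u₂))·log((ch−du₂)/h)`. -/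
noncomputable def wilksF (u₁ u₂ : ℝ) : ℝ :=
  ((u₂ - 1) / u₂) * Real.log (fisherC u₁ u₂) +
    ((u₁ - 1) / u₁) * Real.log (fisherC u₁ u₂ - fisherD u₁ u₂ * fisherH u₁ u₂) +
    ((u₁ + u₂) / (u₁ * u₂)) *
      Real.log ((fisherC u₁ u₂ * fisherH u₁ u₂ - fisherD u₁ u₂ * u₂) / fisherH u₁ u₂)


lemma aux_log3 {w : ℂ} (hw : ‖w‖ ≤ 1/2) : ‖Complex.log (1 + w) - (w - w^2/2)‖ ≤ ‖w‖^3 := by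
  have h := Complex.norm_log_sub_logTaylor_le 2 (z := w) (by linarith)
  have e : Complex.logTaylor (2+1) w = w - w^2/2 := by
    simp [Complex.logTaylor, Finset.sum_range_succ]; ring
  rw [e] at h
  refine h.trans ?_
  have h1 : (1 - ‖w‖)⁻¹ ≤ 2 := by
    rw [inv_le_comm₀ (by linarith) (by norm_num)]; linarith
  have h0 := norm_nonneg w
  have : ‖w‖^3 * (1 - ‖w‖)⁻¹ ≤ ‖w‖^3 * 2 := by gcongr
  norm_num at this ⊢
  nlinarith [pow_nonneg h0 3]

noncomputable def gdel (z : ℂ) (x : ℝ) : ℂ :=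
  Complex.log (1 + z / x) - z * Real.log (1 + 1 / x) - (z^2 - z)/2 * (1/(x+1) - 1/x)

lemma gdel_bound (z : ℂ) : ∃ K : ℝ, 0 ≤ K ∧ ∀ x : ℝ, 2 * (‖z‖ + 1) ≤ x → ‖gdel z x‖ ≤ K / x^3 := by
  refine ⟨‖z‖^3 + ‖z‖ + ‖z^2 - z‖, by positivity, fun x hx => ?_⟩
  have hz := norm_nonneg z
  have hx0 : 0 < x := by linarith
  have hxc : (x:ℂ) ≠ 0 := by exact_mod_cast hx0.ne'
  have hxc1 : (x:ℂ) + 1 ≠ 0 := by exact_mod_cast (by linarith : x + 1 ≠ 0)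
  have h1 := aux_log3 (w := z / x) (by
    rw [norm_div, Complex.norm_real, Real.norm_of_nonneg hx0.le, div_le_iff₀ hx0]; linarith)
  have h2 := aux_log3 (w := 1 / (x:ℂ)) (by
    rw [norm_div, Complex.norm_real, Real.norm_of_nonneg hx0.le, div_le_iff₀ hx0]; simp; linarith)
  have e2 : (Real.log (1 + 1/x) : ℂ) = Complex.log (1 + 1/(x:ℂ)) := by
    rw [Complex.ofReal_log (by positivity)]; push_cast; rfl
  have key : gdel z x = (Complex.log (1 + z / x) - (z/x - (z/x)^2/2))
      - z * (Complex.log (1 + 1 / (x:ℂ)) - (1/x - (1/x)^2/2)) - (z^2-z)/2 * (1/(x^2*(x+1))) := by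
    rw [gdel, e2]; field_simp; ring
  rw [key]
  refine (norm_sub_le _ _).trans ?_
  have h3 : ‖(z^2-z)/2 * (1/((x:ℂ)^2*(x+1)))‖ ≤ ‖z^2-z‖ / x^3 := by
    have e3 : ((x:ℂ)^2*(x+1)) = ((x^2*(x+1) : ℝ) : ℂ) := by push_cast; rfl
    rw [norm_mul, norm_div, norm_div, e3, Complex.norm_real, Real.norm_of_nonneg (by positivity)]
    have : 1/(x^2*(x+1)) ≤ 1 / x^3 := by
      apply one_div_le_one_div_of_le (by positivity); nlinarith [sq_nonneg x]
    simp only [norm_one, Complex.norm_ofNat]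
    calc _ ≤ ‖z^2-z‖/2 * (1/x^3) := by gcongr
      _ ≤ _ := by
        rw [div_mul_div_comm, mul_one]
        gcongr
        nlinarith [pow_pos hx0 3]
  have h4 : ‖Complex.log (1 + z / x) - (z/x - (z/x)^2/2)‖ ≤ ‖z‖^3/x^3 := by
    refine h1.trans_eq ?_
    rw [norm_div, Complex.norm_real, Real.norm_of_nonneg hx0.le, div_pow]
  have h5 : ‖z * (Complex.log (1 + 1 / (x:ℂ)) - (1/x - (1/x)^2/2))‖ ≤ ‖z‖ / x^3 := by
    rw [norm_mul, div_eq_mul_one_div ‖z‖]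
    gcongr
    refine h2.trans_eq ?_
    rw [norm_div, Complex.norm_real, Real.norm_of_nonneg hx0.le, div_pow]; simp
  have h6 := norm_sub_le (Complex.log (1 + z / x) - (z/x - (z/x)^2/2)) (z * (Complex.log (1 + 1 / (x:ℂ)) - (1/x - (1/x)^2/2)))
  rw [add_div, add_div]
  linarith

lemma cube_sum (a : ℝ) (ha : 2 ≤ a) (n : ℕ) :
    ∑ j ∈ Finset.range n, 1 / (a + j)^3 ≤ 1/(a-1)^2 - 1/(a + n - 1)^2 := by
  induction n with
  | zero => simp
  | succ n ih =>
    rw [Finset.sum_range_succ]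
    have hx : 2 ≤ a + n := by have : (0:ℝ) ≤ n := n.cast_nonneg; linarith
    push_cast
    set x := a + n with hxd
    have : 1/x^3 ≤ 1/(x-1)^2 - 1/x^2 := by
      have h1 : 0 < x - 1 := by linarith
      have h0 : 0 < x := by linarith
      rw [div_sub_div _ _ (by positivity) (by positivity), div_le_div_iff₀ (by positivity) (by positivity)]
      have h2 : 0 ≤ x^2 * (x * (2*x-1) - (x-1)^2) := by
        apply mul_nonneg (by positivity); nlinarith
      nlinarith
    have e : a + (n + 1) - 1 = x := by rw [hxd]; ring
    rw [e]; linarith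

lemma gamma_ratio (z : ℂ) : ∃ C : ℝ, 0 ≤ C ∧ ∀ a : ℝ, 2 * (‖z‖ + 1) ≤ a → ∃ D : ℂ, ‖D‖ ≤ C / a^2 ∧
    Complex.Gamma (a + z) / Complex.Gamma a = Complex.exp (z * Real.log a + (z^2 - z)/2 * (1/a) + D) := by
  obtain ⟨K, hK, hb⟩ := gdel_bound z
  refine ⟨4*K, by positivity, fun a ha => ?_⟩
  have hz := norm_nonneg z
  have ha0 : 0 < a := by linarith
  have ha2 : 2 ≤ a := by linarith
  have hsum : ∀ n, ∑ j ∈ Finset.range n, ‖gdel z (a + j)‖ ≤ 4*K/a^2 := by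
    intro n
    calc _ ≤ ∑ j ∈ Finset.range n, K * (1 / (a + j)^3) := by
          apply Finset.sum_le_sum; intro j _
          rw [mul_one_div]; apply hb
          have : (0:ℝ) ≤ j := j.cast_nonneg
          linarith
      _ ≤ K * (1/(a-1)^2) := by
          rw [← Finset.mul_sum]
          have := cube_sum a ha2 n
          have h2 : 0 ≤ 1/(a + n - 1)^2 := by positivity
          gcongr; linarith
      _ ≤ K * (4 / a^2) := by
          gcongr K * ?_
          rw [div_le_div_iff₀ (by have : 0 < a - 1 := by linarith
                                  positivity) (by positivity)]
          nlinarith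
      _ = _ := by ring
  have hs : Summable (fun j : ℕ => ‖gdel z (a + j)‖) :=
    summable_of_sum_range_le (fun _ => norm_nonneg _) hsum
  have hs' := hs.of_norm
  have hlim := hs'.hasSum.tendsto_sum_nat
  refine ⟨-∑' j : ℕ, gdel z (a + j), ?_, ?_⟩
  · rw [norm_neg]
    refine (norm_tsum_le_tsum_norm hs).trans ?_
    exact hs.tsum_le_of_sum_range_le hsum
  have hre : Complex.Gamma a ≠ 0 := by
    rw [Complex.Gamma_ofReal]; exact_mod_cast (Real.Gamma_pos_of_pos ha0).ne'
  have hT := (Complex.GammaSeq_tendsto_Gamma (a + z)).div (Complex.GammaSeq_tendsto_Gamma a) hre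
  refine tendsto_nhds_unique hT ?_
  have hl2 : Tendsto (fun n : ℕ => Complex.exp (-(∑ j ∈ Finset.range (n+1), gdel z (a+j)) +
      z * ((Real.log a - Real.log ((a + n + 1) / n) : ℝ) : ℂ) + (z^2-z)/2 * ((1/a - 1/(a+n+1) : ℝ) : ℂ))) atTop
      (nhds (Complex.exp (-(∑' j : ℕ, gdel z (a + j)) + z * ((Real.log a - Real.log 1 : ℝ) : ℂ)
        + (z^2-z)/2 * ((1/a - 0 : ℝ) : ℂ)))) := by
    have t1 : Tendsto (fun n : ℕ => (a + n + 1) / n) atTop (nhds 1) := by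
      have h := (tendsto_const_div_atTop_nhds_zero_nat (a+1)).add_const 1
      rw [zero_add] at h
      refine h.congr' ?_
      filter_upwards [eventually_gt_atTop 0] with n hn
      have : (n:ℝ) ≠ 0 := by positivity
      field_simp; ring
    have t2 : Tendsto (fun n : ℕ => 1/(a + n + 1)) atTop (nhds 0) := by
      have h : Tendsto (fun n : ℕ => a + n + 1) atTop atTop :=
        tendsto_atTop_add_const_right _ _ (tendsto_atTop_add_const_left _ _ tendsto_natCast_atTop_atTop)
      simp only [one_div]; exact h.inv_tendsto_atTop
    have t3 := (Real.continuousAt_log one_ne_zero).tendsto.comp t1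
    refine (Complex.continuous_exp.tendsto _).comp ?_
    refine ((hlim.comp (tendsto_add_atTop_nat 1)).neg.add ?_).add ?_
    · exact ((Complex.continuous_ofReal.tendsto _).comp (t3.const_sub _)).const_mul _
    · exact ((Complex.continuous_ofReal.tendsto _).comp (t2.const_sub _)).const_mul _
  have hE : (Complex.exp (-(∑' j : ℕ, gdel z (a + j)) + z * ((Real.log a - Real.log 1 : ℝ) : ℂ)
        + (z^2-z)/2 * ((1/a - 0 : ℝ) : ℂ))) = Complex.exp (z * Real.log a + (z^2 - z)/2 * (1/a) + -∑' j : ℕ, gdel z (a + j)) := by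
    congr 1; simp; ring
  rw [hE] at hl2
  refine hl2.congr' ?_
  filter_upwards [eventually_gt_atTop 0] with n hn
  have hn0 : (n:ℂ) ≠ 0 := by exact_mod_cast hn.ne'
  have hnr : (n:ℝ) ≠ 0 := by exact_mod_cast hn.ne'
  have step : ∀ m : ℕ, Complex.exp (-(∑ j ∈ Finset.range m, gdel z (a+j)) +
      z * ((Real.log a - Real.log (a + m) : ℝ) : ℂ) + (z^2-z)/2 * ((1/a - 1/(a+m) : ℝ) : ℂ)) =
      ∏ j ∈ Finset.range m, ((a + j : ℂ) / (a + z + j)) := by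
    intro m
    induction m with
    | zero => simp
    | succ m ih =>
      rw [Finset.sum_range_succ, Finset.prod_range_succ, ← ih]
      have hm : (0:ℝ) ≤ m := m.cast_nonneg
      have hx : 0 < a + m := by linarith
      have hxc : (a + m : ℂ) ≠ 0 := by exact_mod_cast hx.ne'
      have hne : (a + z + m : ℂ) ≠ 0 := by
        intro h
        have h2 : z = -((a + m : ℝ):ℂ) := by push_cast; linear_combination h
        have h3 : ‖z‖ = a + m := by rw [h2, norm_neg, Complex.norm_real, Real.norm_of_nonneg hx.le]
        linarith
      have h1 : (a + m : ℂ) / (a + z + m) = Complex.exp (-Complex.log (1 + z / ((a + m : ℝ):ℂ))) := by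
        have e4 : 1 + z / ((a + m : ℝ):ℂ) = (a + z + m) / (a + m) := by push_cast; field_simp; ring
        rw [Complex.exp_neg, e4, Complex.exp_log (div_ne_zero hne hxc), inv_div]
      rw [h1, ← Complex.exp_add]
      congr 1
      have e5 : Real.log (1 + 1/(a+m)) = Real.log (a + m + 1) - Real.log (a + m) := by
        rw [← Real.log_div (by linarith) hx.ne']; congr 1; field_simp
      rw [gdel, e5]
      push_cast
      ring
  have s := step (n+1)
  have e6 : Complex.GammaSeq (a+z) n / Complex.GammaSeq a n = (n:ℂ)^z * ∏ j ∈ Finset.range (n+1), ((a + j : ℂ) / (a + z + j)) := by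
    rw [Complex.GammaSeq, Complex.GammaSeq, Finset.prod_div_distrib, Complex.cpow_add _ _ hn0]
    have hf : ((n.factorial : ℕ) : ℂ) ≠ 0 := by exact_mod_cast n.factorial_ne_zero
    have hc : (n:ℂ)^(a:ℂ) ≠ 0 := by simp [Complex.cpow_eq_zero_iff, hn0]
    field_simp
  simp only [Pi.div_apply]
  rw [e6, ← s, Complex.cpow_def_of_ne_zero hn0, ← Complex.exp_add]
  congr 1
  have hpos : a + n + 1 ≠ 0 := by positivity
  rw [Real.log_div hpos hnr]
  have : Complex.log n = ((Real.log n : ℝ):ℂ) := by rw [Complex.ofReal_log (by positivity)]; simp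
  rw [this]
  push_cast
  rw [← add_assoc (a:ℂ) n 1, ← add_assoc (a:ℝ) n 1]
  ring

/-- product of Gamma ratios -/
noncomputable def gprod (z : ℂ) (n p : ℕ) : ℂ :=
  ∏ k ∈ Finset.range p, Complex.Gamma (((n - k : ℕ) : ℂ) / 2 + z) / Complex.Gamma (((n - k : ℕ) : ℂ) / 2)

lemma gprod_eq (z : ℂ) : ∃ C : ℝ, 0 ≤ C ∧ ∀ n p : ℕ, p ≤ n → 4 * (‖z‖ + 1) ≤ ((n - p : ℕ) : ℝ) →
    ∃ E : ℂ, ‖E‖ ≤ C * (p / ((n - p : ℕ) : ℝ)^2) ∧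
    gprod z n p = Complex.exp (z * ((∑ k ∈ Finset.range p, Real.log (((n - k : ℕ) : ℝ)/2) : ℝ) : ℂ)
      + (z^2 - z)/2 * ((∑ k ∈ Finset.range p, 2 / ((n - k : ℕ) : ℝ) : ℝ) : ℂ) + E) := by
  obtain ⟨C, hC, h⟩ := gamma_ratio z
  refine ⟨4 * C, by positivity, fun n p hpn hn => ?_⟩
  have hz := norm_nonneg z
  have hle : ∀ k ∈ Finset.range p, ((n - p : ℕ):ℝ) ≤ ((n - k : ℕ) : ℝ) := by
    intro k hk
    have := Finset.mem_range.1 hk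
    exact_mod_cast (by omega : n - p ≤ n - k)
  have h' : ∀ k : ℕ, ∃ D : ℂ, k ∈ Finset.range p → (‖D‖ ≤ C / (((n - k : ℕ):ℝ)/2)^2 ∧
      Complex.Gamma (((n - k : ℕ) : ℂ) / 2 + z) / Complex.Gamma (((n - k : ℕ) : ℂ) / 2) =
      Complex.exp (z * Real.log (((n - k : ℕ):ℝ)/2) + (z^2 - z)/2 * (1/((((n - k : ℕ):ℝ)/2 : ℝ) : ℂ)) + D)) := by
    intro k
    by_cases hk : k ∈ Finset.range p
    · obtain ⟨D, hD1, hD2⟩ := h (((n - k : ℕ):ℝ)/2) (by linarith [hle k hk])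
      refine ⟨D, fun _ => ⟨hD1, ?_⟩⟩
      rw [← hD2]; push_cast; rfl
    · exact ⟨0, fun h => absurd h hk⟩
  choose D hD using h'
  have hpos : 0 < ((n - p : ℕ):ℝ) := by linarith
  refine ⟨∑ k ∈ Finset.range p, D k, ?_, ?_⟩
  · calc _ ≤ ∑ k ∈ Finset.range p, ‖D k‖ := norm_sum_le _ _
      _ ≤ ∑ k ∈ Finset.range p, 4 * C / ((n - p : ℕ):ℝ)^2 := by
        apply Finset.sum_le_sum; intro k hk
        refine (hD k hk).1.trans ?_
        rw [div_pow, div_div_eq_mul_div, mul_comm C]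
        norm_num
        have := hle k hk
        gcongr
      _ = _ := by simp; ring
  · rw [gprod, Finset.prod_congr rfl (fun k hk => (hD k hk).2), ← Complex.exp_sum]
    congr 1
    rw [Finset.sum_add_distrib, Finset.sum_add_distrib]
    push_cast
    rw [Finset.mul_sum, Finset.mul_sum]
    congr 2
    apply Finset.sum_congr rfl; intro k _; simp

lemma logsum_eq (n p : ℕ) (hpn : p ≤ n) : ∑ k ∈ Finset.range p, Real.log (((n - k : ℕ) : ℝ)/2) =
    Real.log n.factorial - Real.log (n - p).factorial - p * Real.log 2 := by
  induction p with
  | zero => simp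
  | succ p ih =>
    rw [Finset.sum_range_succ, ih (by omega)]
    obtain ⟨m, rfl⟩ : ∃ m, n = m + p + 1 := ⟨n - p - 1, by omega⟩
    have e1 : m + p + 1 - p = m + 1 := by omega
    have e2 : m + p + 1 - (p + 1) = m := by omega
    rw [e1, e2, Nat.factorial_succ m]
    have : (m.factorial : ℝ) ≠ 0 := by exact_mod_cast m.factorial_ne_zero
    have hm : ((m+1 : ℕ):ℝ) ≠ 0 := by exact_mod_cast m.succ_ne_zero
    rw [Real.log_div hm (by norm_num), Nat.cast_mul, Real.log_mul hm this]
    push_cast; ring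

lemma harmsum_eq (n p : ℕ) (hpn : p ≤ n) : ∑ k ∈ Finset.range p, 2 / ((n - k : ℕ) : ℝ) =
    2 * ((harmonic n : ℝ) - harmonic (n - p)) := by
  induction p with
  | zero => simp
  | succ p ih =>
    rw [Finset.sum_range_succ, ih (by omega)]
    obtain ⟨m, rfl⟩ : ∃ m, n = m + p + 1 := ⟨n - p - 1, by omega⟩
    have e1 : m + p + 1 - p = m + 1 := by omega
    have e2 : m + p + 1 - (p + 1) = m := by omega
    rw [e1, e2, harmonic_succ m]
    push_cast; ring

lemma seq_facts {n p : ℕ → ℕ} {y : ℝ} (hy : y ∈ Set.Ioo (0:ℝ) 1) (hn : Tendsto n atTop atTop)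
    (h : Tendsto (fun t => (p t : ℝ) / n t) atTop (nhds y)) :
    (∀ᶠ t in atTop, p t < n t) ∧ Tendsto (fun t => n t - p t) atTop atTop ∧
    Tendsto (fun t => ((n t - p t : ℕ) : ℝ) / n t) atTop (nhds (1 - y)) := by
  have hlt : ∀ᶠ t in atTop, p t < n t := by
    filter_upwards [h.eventually_lt_const hy.2, hn.eventually_gt_atTop 0] with t h1 h2
    rw [div_lt_one (by exact_mod_cast h2)] at h1
    exact_mod_cast h1
  have hr : Tendsto (fun t => ((n t - p t : ℕ) : ℝ) / n t) atTop (nhds (1 - y)) := by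
    refine (h.const_sub 1).congr' ?_
    filter_upwards [hlt, hn.eventually_gt_atTop 0] with t h1 h2
    have : (n t : ℝ) ≠ 0 := by exact_mod_cast h2.ne'
    rw [Nat.cast_sub h1.le]; field_simp
  refine ⟨hlt, ?_, hr⟩
  have hc := (tendsto_natCast_atTop_atTop (R := ℝ)).comp hn
  have := hr.pos_mul_atTop (by linarith [hy.2]) hc
  rw [← tendsto_natCast_atTop_iff (R := ℝ)]
  refine this.congr' ?_
  filter_upwards [hn.eventually_gt_atTop 0] with t h2
  have : (n t : ℝ) ≠ 0 := by exact_mod_cast h2.ne'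
  simp only [Function.comp]; field_simp

/-- centering term -/
noncomputable def gcent (n p : ℝ) : ℝ := n * Real.log n - (n - p) * Real.log (n - p) - p - p * Real.log 2

lemma gprod_tendsto (z : ℂ) {n p : ℕ → ℕ} {y : ℝ} (hy : y ∈ Set.Ioo (0:ℝ) 1) (hn : Tendsto n atTop atTop)
    (h : Tendsto (fun t => (p t : ℝ) / n t) atTop (nhds y)) :
    Tendsto (fun t => gprod z (n t) (p t) * Complex.exp (-z * (gcent (n t) (p t) : ℂ))) atTop
      (nhds (Complex.exp (-(z^2 - z/2) * (Real.log (1 - y) : ℂ)))) := by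
  obtain ⟨hlt, hnp, hr⟩ := seq_facts hy hn h
  obtain ⟨C, hC, hg⟩ := gprod_eq z
  have hy1 : 0 < 1 - y := by linarith [hy.2]
  have hl : Tendsto (fun t => Real.log (((n t - p t : ℕ) : ℝ) / n t)) atTop (nhds (Real.log (1-y))) :=
    (Real.continuousAt_log hy1.ne').tendsto.comp hr
  have hcast := (tendsto_natCast_atTop_atTop (R := ℝ)).comp hnp
  have hbig : ∀ᶠ t in atTop, 4 * (‖z‖ + 1) ≤ ((n t - p t : ℕ) : ℝ) := hcast.eventually_ge_atTop _
  -- log sums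
  have hS : Tendsto (fun t => (∑ k ∈ Finset.range (p t), Real.log (((n t - k : ℕ) : ℝ)/2)) - gcent (n t) (p t)) atTop
      (nhds (-(1/2) * Real.log (1-y))) := by
    have hst := (Real.continuousAt_log (Real.sqrt_pos.2 Real.pi_pos).ne').tendsto.comp Stirling.tendsto_stirlingSeq_sqrt_pi
    have h1 := ((hst.comp hn).sub (hst.comp hnp)).add (hl.const_mul (-(1/2)))
    rw [sub_self, zero_add] at h1
    refine h1.congr' ?_
    filter_upwards [hlt, hn.eventually_gt_atTop 0] with t h1 h2
    have hm0 : 0 < n t - p t := by omega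
    have a1 : 0 < (n t : ℝ) := by exact_mod_cast h2
    have a2 : 0 < ((n t - p t : ℕ) : ℝ) := by exact_mod_cast hm0
    have e : ((n t - p t : ℕ) : ℝ) = n t - p t := Nat.cast_sub h1.le
    simp only [Function.comp]
    rw [logsum_eq _ _ h1.le, Stirling.log_stirlingSeq_formula, Stirling.log_stirlingSeq_formula, gcent,
      Real.log_div a1.ne' (Real.exp_pos 1).ne', Real.log_div a2.ne' (Real.exp_pos 1).ne', Real.log_exp,
      Real.log_mul (by norm_num) a1.ne', Real.log_mul (by norm_num) a2.ne', Real.log_div a2.ne' a1.ne', ← e]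
    have e' : (p t : ℝ) = n t - ((n t - p t : ℕ) : ℝ) := by rw [e]; ring
    rw [e']
    ring
  have hH : Tendsto (fun t => ∑ k ∈ Finset.range (p t), 2 / ((n t - k : ℕ) : ℝ)) atTop (nhds (-2 * Real.log (1-y))) := by
    have hst := Real.tendsto_harmonic_sub_log
    have h1 := ((((hst.comp hn).sub (hst.comp hnp))).sub hl).const_mul 2
    rw [sub_self, zero_sub, mul_neg, ← neg_mul] at h1
    refine h1.congr' ?_
    filter_upwards [hlt, hn.eventually_gt_atTop 0] with t h1 h2
    have hm0 : 0 < n t - p t := by omega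
    have a1 : 0 < (n t : ℝ) := by exact_mod_cast h2
    have a2 : 0 < ((n t - p t : ℕ) : ℝ) := by exact_mod_cast hm0
    simp only [Function.comp]
    rw [harmsum_eq _ _ h1.le, Real.log_div a2.ne' a1.ne']
    ring
  have hE : ∃ E : ℕ → ℂ, Tendsto E atTop (nhds 0) ∧ ∀ᶠ t in atTop, gprod z (n t) (p t) =
      Complex.exp (z * ((∑ k ∈ Finset.range (p t), Real.log (((n t - k : ℕ) : ℝ)/2) : ℝ) : ℂ)
      + (z^2 - z)/2 * ((∑ k ∈ Finset.range (p t), 2 / ((n t - k : ℕ) : ℝ) : ℝ) : ℂ) + E t) := by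
    have : ∀ t, ∃ E : ℂ, (p t < n t ∧ 4 * (‖z‖ + 1) ≤ ((n t - p t : ℕ) : ℝ)) →
        (‖E‖ ≤ C * (p t / ((n t - p t : ℕ) : ℝ)^2) ∧ gprod z (n t) (p t) =
      Complex.exp (z * ((∑ k ∈ Finset.range (p t), Real.log (((n t - k : ℕ) : ℝ)/2) : ℝ) : ℂ)
      + (z^2 - z)/2 * ((∑ k ∈ Finset.range (p t), 2 / ((n t - k : ℕ) : ℝ) : ℝ) : ℂ) + E)) := by
      intro t
      by_cases hc : p t < n t ∧ 4 * (‖z‖ + 1) ≤ ((n t - p t : ℕ) : ℝ)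
      · obtain ⟨E, hE⟩ := hg (n t) (p t) hc.1.le hc.2
        exact ⟨E, fun _ => hE⟩
      · exact ⟨0, fun h => absurd h hc⟩
    choose E hE using this
    refine ⟨E, ?_, ?_⟩
    · have hb : Tendsto (fun t => C * (p t / ((n t - p t : ℕ) : ℝ)^2)) atTop (nhds 0) := by
        have h1 := ((h.div hr hy1.ne').mul hcast.inv_tendsto_atTop).const_mul C
        rw [mul_zero, mul_zero] at h1
        refine h1.congr' ?_
        filter_upwards [hlt, hn.eventually_gt_atTop 0] with t h1 h2
        have hm0 : 0 < n t - p t := by omega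
        have a1 : (n t : ℝ) ≠ 0 := by exact_mod_cast h2.ne'
        have a2 : ((n t - p t : ℕ) : ℝ) ≠ 0 := by exact_mod_cast hm0.ne'
        simp only [Pi.div_apply, Pi.inv_apply, Function.comp]
        field_simp
      refine squeeze_zero_norm' ?_ hb
      filter_upwards [hlt, hbig] with t h1 h2
      exact (hE t ⟨h1, h2⟩).1
    · filter_upwards [hlt, hbig] with t h1 h2
      exact (hE t ⟨h1, h2⟩).2
  obtain ⟨E, hE0, hE⟩ := hE
  have hfin : Tendsto (fun t => Complex.exp (z * (((∑ k ∈ Finset.range (p t), Real.log (((n t - k : ℕ) : ℝ)/2)) - gcent (n t) (p t) : ℝ) : ℂ)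
      + (z^2 - z)/2 * ((∑ k ∈ Finset.range (p t), 2 / ((n t - k : ℕ) : ℝ) : ℝ) : ℂ) + E t)) atTop
      (nhds (Complex.exp (z * ((-(1/2) * Real.log (1-y) : ℝ):ℂ) + (z^2-z)/2 * ((-2 * Real.log (1-y) : ℝ) : ℂ) + 0))) := by
    refine (Complex.continuous_exp.tendsto _).comp ?_
    refine (Tendsto.add ?_ ?_).add hE0
    · exact ((Complex.continuous_ofReal.tendsto _).comp hS).const_mul _
    · exact ((Complex.continuous_ofReal.tendsto _).comp hH).const_mul _
  have e : Complex.exp (z * ((-(1/2) * Real.log (1-y) : ℝ):ℂ) + (z^2-z)/2 * ((-2 * Real.log (1-y) : ℝ) : ℂ) + 0) =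
      Complex.exp (-(z^2 - z/2) * (Real.log (1 - y) : ℂ)) := by
    congr 1; push_cast; ring
  rw [e] at hfin
  refine hfin.congr' ?_
  filter_upwards [hE] with t ht
  rw [ht, ← Complex.exp_add]
  congr 1; push_cast; ring

lemma fisherH_sq {u₁ u₂ : ℝ} (h1 : u₁ ∈ Set.Ioo (0:ℝ) 1) (h2 : u₂ ∈ Set.Ioo (0:ℝ) 1) :
    fisherH u₁ u₂ ^ 2 = u₁ + u₂ - u₁ * u₂ := by
  rw [fisherH, Real.sq_sqrt]; nlinarith [h1.1, h1.2, h2.1, h2.2]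

lemma fisherH_pos {u₁ u₂ : ℝ} (h1 : u₁ ∈ Set.Ioo (0:ℝ) 1) (h2 : u₂ ∈ Set.Ioo (0:ℝ) 1) :
    0 < fisherH u₁ u₂ := by
  rw [fisherH]; apply Real.sqrt_pos.2; nlinarith [h1.1, h1.2, h2.1, h2.2]

lemma fisherH_gt {u₁ u₂ : ℝ} (h1 : u₁ ∈ Set.Ioo (0:ℝ) 1) (h2 : u₂ ∈ Set.Ioo (0:ℝ) 1) :
    u₂ < fisherH u₁ u₂ := by
  rw [fisherH]; apply Real.lt_sqrt_of_sq_lt; nlinarith [h1.1, h1.2, h2.1, h2.2, mul_pos h1.1 h2.1, mul_pos h1.1 (sub_pos.2 h2.2), mul_pos h2.1 (sub_pos.2 h2.2)]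

lemma fisher_sqrtB {u₁ u₂ : ℝ} (h1 : u₁ ∈ Set.Ioo (0:ℝ) 1) (h2 : u₂ ∈ Set.Ioo (0:ℝ) 1) :
    Real.sqrt (1 + (u₂ / u₁) * fisherB u₁ u₂) = (fisherH u₁ u₂ + u₂) / (√u₁ * (1 - u₂)) := by
  have hs := fisherH_sq h1 h2
  have hp := fisherH_pos h1 h2
  have hu : 0 < 1 - u₂ := by linarith [h2.2]
  have hu1 := h1.1
  have hu2 := h2.1
  have hq : √u₁ ^ 2 = u₁ := Real.sq_sqrt hu1.le
  have key : 1 + (u₂ / u₁) * fisherB u₁ u₂ = ((fisherH u₁ u₂ + u₂) / (√u₁ * (1 - u₂)))^2 := by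
    rw [fisherB, div_pow, mul_pow, hq]
    field_simp
    linear_combination (u₂ - 1) * hs
  rw [key, Real.sqrt_sq (by positivity)]

lemma fisher_sqrtA {u₁ u₂ : ℝ} (h1 : u₁ ∈ Set.Ioo (0:ℝ) 1) (h2 : u₂ ∈ Set.Ioo (0:ℝ) 1) :
    Real.sqrt (1 + (u₂ / u₁) * fisherA u₁ u₂) = (fisherH u₁ u₂ - u₂) / (√u₁ * (1 - u₂)) := by
  have hs := fisherH_sq h1 h2
  have hp : 0 < fisherH u₁ u₂ - u₂ := sub_pos.2 (fisherH_gt h1 h2)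
  have hu : 0 < 1 - u₂ := by linarith [h2.2]
  have hu1 := h1.1
  have hu2 := h2.1
  have hq : √u₁ ^ 2 = u₁ := Real.sq_sqrt hu1.le
  have key : 1 + (u₂ / u₁) * fisherA u₁ u₂ = ((fisherH u₁ u₂ - u₂) / (√u₁ * (1 - u₂)))^2 := by
    rw [fisherA, div_pow, mul_pow, hq]
    field_simp
    linear_combination (u₂ - 1) * hs
  rw [key, Real.sqrt_sq (by positivity)]

lemma fisherC_eq {u₁ u₂ : ℝ} (h1 : u₁ ∈ Set.Ioo (0:ℝ) 1) (h2 : u₂ ∈ Set.Ioo (0:ℝ) 1) :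
    fisherC u₁ u₂ = fisherH u₁ u₂ / (√u₁ * (1 - u₂)) := by
  rw [fisherC, fisher_sqrtA h1 h2, fisher_sqrtB h1 h2]; ring

lemma fisherD_eq {u₁ u₂ : ℝ} (h1 : u₁ ∈ Set.Ioo (0:ℝ) 1) (h2 : u₂ ∈ Set.Ioo (0:ℝ) 1) :
    fisherD u₁ u₂ = u₂ / (√u₁ * (1 - u₂)) := by
  rw [fisherD, fisher_sqrtA h1 h2, fisher_sqrtB h1 h2]; ring

lemma wilksMean_eq {u₁ u₂ : ℝ} (h1 : u₁ ∈ Set.Ioo (0:ℝ) 1) (h2 : u₂ ∈ Set.Ioo (0:ℝ) 1) :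
    wilksMean u₁ u₂ = 1/2 * Real.log ((u₁ + u₂ - u₁ * u₂) / ((1 - u₂) * (u₁ + u₂))) := by
  have hs := fisherH_sq h1 h2
  have hp := fisherH_pos h1 h2
  have hu : 0 < 1 - u₂ := by linarith [h2.2]
  have hu1 := h1.1
  have hu2 := h2.1
  have hq : √u₁ ^ 2 = u₁ := Real.sq_sqrt hu1.le
  have hqp : 0 < √u₁ := Real.sqrt_pos.2 hu1
  rw [wilksMean, fisherC_eq h1 h2, fisherD_eq h1 h2]
  congr 2
  have e1 : (fisherH u₁ u₂ / (√u₁ * (1 - u₂))) ^ 2 - (u₂ / (√u₁ * (1 - u₂))) ^ 2 =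
      (u₁ + u₂) / (u₁ * (1 - u₂)) := by
    rw [div_pow, div_pow, mul_pow, hq, hs]; field_simp; ring
  have e2 : (fisherH u₁ u₂ / (√u₁ * (1 - u₂)) * fisherH u₁ u₂ - u₂ * (u₂ / (√u₁ * (1 - u₂)))) =
      (u₁ + u₂) / √u₁ := by
    field_simp; rw [hs]; ring
  rw [e1, e2, hs, div_pow, hq]
  field_simp

lemma wilksVar_eq {u₁ u₂ : ℝ} (h1 : u₁ ∈ Set.Ioo (0:ℝ) 1) (h2 : u₂ ∈ Set.Ioo (0:ℝ) 1) :
    wilksVar u₁ u₂ = 2 * Real.log ((u₁ + u₂ - u₁ * u₂) / ((1 - u₂) * (u₁ + u₂))) := by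
  have hs := fisherH_sq h1 h2
  have hu : 0 < 1 - u₂ := by linarith [h2.2]
  have hu1 := h1.1
  have hu2 := h2.1
  have hq : √u₁ ^ 2 = u₁ := Real.sq_sqrt hu1.le
  rw [wilksVar, fisherC_eq h1 h2, fisherD_eq h1 h2]
  congr 2
  rw [div_pow, div_pow, mul_pow, hq, hs]
  have e1 : (u₁ + u₂ - u₁ * u₂) / (u₁ * (1 - u₂)^2) - u₂^2 / (u₁ * (1 - u₂)^2) = (u₁ + u₂) / (u₁ * (1 - u₂)) := by
    field_simp; ring
  rw [e1]
  field_simp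

lemma wilksVar_nonneg {u₁ u₂ : ℝ} (h1 : u₁ ∈ Set.Ioo (0:ℝ) 1) (h2 : u₂ ∈ Set.Ioo (0:ℝ) 1) :
    0 ≤ wilksVar u₁ u₂ := by
  rw [wilksVar_eq h1 h2]
  have hu : 0 < 1 - u₂ := by linarith [h2.2]
  have hu1 := h1.1
  have hu2 := h2.1
  refine mul_nonneg (by norm_num) (Real.log_nonneg ?_)
  rw [le_div_iff₀ (by positivity)]
  nlinarith

lemma wilksF_eq {p q r : ℝ} (hp : 0 < p) (hq : p < q) (hr : p < r) :
    p * wilksF (p / q) (p / r) = ((r+q) * Real.log (r+q) - (r+q-p) * Real.log (r+q-p))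
      - (r * Real.log r - (r - p) * Real.log (r - p)) := by
  have hq0 : 0 < q := hp.trans hq
  have hr0 : 0 < r := hp.trans hr
  have h1 : p / q ∈ Set.Ioo (0:ℝ) 1 := ⟨by positivity, (div_lt_one hq0).2 hq⟩
  have h2 : p / r ∈ Set.Ioo (0:ℝ) 1 := ⟨by positivity, (div_lt_one hr0).2 hr⟩
  have hs := fisherH_sq h1 h2
  have hh := fisherH_pos h1 h2
  have hrp : 0 < r - p := by linarith
  have hN : 0 < r + q - p := by linarith
  have hu : 0 < 1 - p / r := by linarith [h2.2]
  have hqp : 0 < √(p/q) := Real.sqrt_pos.2 h1.1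
  rw [wilksF, fisherC_eq h1 h2, fisherD_eq h1 h2]
  set s := √(p/q) with hsd
  set h := fisherH (p/q) (p/r) with hhd
  have l1 : Real.log s = 1/2 * (Real.log p - Real.log q) := by
    rw [hsd, Real.log_sqrt h1.1.le, Real.log_div hp.ne' hq0.ne']; ring
  have hs' : h^2 = p * (r+q-p) / (q * r) := by rw [hs]; field_simp
  have l2 : Real.log h = 1/2 * (Real.log p + Real.log (r+q-p) - Real.log q - Real.log r) := by
    have := congrArg Real.log hs'
    rw [Real.log_pow, Real.log_div (by positivity) (by positivity), Real.log_mul (by positivity) (by positivity),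
      Real.log_mul (by positivity) (by positivity)] at this
    push_cast at this; linarith
  have l3 : Real.log (1 - p/r) = Real.log (r - p) - Real.log r := by
    rw [← Real.log_div hrp.ne' hr0.ne']; congr 1; field_simp
  have e1 : h / (s * (1 - p/r)) - p/r / (s * (1 - p/r)) * h = h / s := by
    have hv : (1 - p/r) ≠ 0 := hu.ne'
    generalize p/r = v at hv ⊢
    field_simp
  have e2 : (h / (s * (1 - p/r)) * h - p/r / (s * (1 - p/r)) * (p/r)) / h = p * (r+q) / (q * r) / (h * s) := by
    have hv : (1 - p/r) ≠ 0 := hu.ne'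
    have e3 : p * (r+q) / (q * r) = (h^2 - (p/r)^2) / (1 - p/r) := by
      rw [eq_div_iff hv, hs]; field_simp; ring
    rw [e3]
    generalize p/r = v at hv ⊢
    field_simp
  rw [e1, e2, Real.log_div hh.ne' (by positivity), Real.log_mul hqp.ne' hu.ne', Real.log_div hh.ne' hqp.ne',
    Real.log_div (by positivity) (by positivity), Real.log_mul hh.ne' hqp.ne',
    Real.log_div (by positivity) (by positivity), Real.log_mul hp.ne' (by positivity),
      Real.log_mul (by positivity) (by positivity), l1, l2, l3]
  field_simp
  ring

section GaussDensity
open Complex in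
lemma stdGaussian_density (E : Type*) [NormedAddCommGroup E] [InnerProductSpace ℝ E] [FiniteDimensional ℝ E]
    [MeasurableSpace E] [BorelSpace E] :
    stdGaussian E = (volume : Measure E).withDensity
      (fun x => ENNReal.ofReal ((2 * Real.pi) ^ (-(Module.finrank ℝ E : ℝ) / 2) * Real.exp (-‖x‖^2/2))) := by
  set c : ℝ := (2 * Real.pi) ^ (-(Module.finrank ℝ E : ℝ) / 2) with hc
  have hc0 : 0 < c := by positivity
  have hint : Integrable (fun x : E => c * Real.exp (-‖x‖^2/2)) := by
    have h := GaussianFourier.integrable_cexp_neg_mul_sq_norm_add (V := E) (b := 1/2) (by norm_num) 0 0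
    have h2 := h.re.const_mul c
    refine h2.congr (ae_of_all _ fun x => ?_)
    simp only
    have : (-(1/2:ℂ) * (‖x‖:ℂ)^2 + 0 * (inner ℝ (0:E) x : ℝ)) = ((-‖x‖^2/2 : ℝ) : ℂ) := by
      push_cast; simp; ring
    rw [this, ← Complex.ofReal_exp]; rfl
  have : IsFiniteMeasure ((volume : Measure E).withDensity
      (fun x => ENNReal.ofReal (c * Real.exp (-‖x‖^2/2)))) :=
    isFiniteMeasure_withDensity_ofReal hint.2
  apply Measure.ext_of_charFun
  ext t
  rw [charFun_stdGaussian, charFun_apply, integral_withDensity_eq_integral_toReal_smul (by fun_prop) (by simp)]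
  have h := GaussianFourier.integral_cexp_neg_mul_sq_norm_add (V := E) (b := 1/2) (by norm_num) I t
  have e : ∀ x : E, (ENNReal.ofReal (c * Real.exp (-‖x‖^2/2))).toReal • cexp (inner ℝ x t * I) =
      (c:ℂ) * cexp (-(1/2) * ‖x‖^2 + I * inner ℝ t x) := by
    intro x
    rw [ENNReal.toReal_ofReal (by positivity), real_inner_comm, Complex.real_smul]
    push_cast
    rw [mul_assoc, ← Complex.exp_add]
    congr 2; ring
  simp_rw [e]
  rw [integral_const_mul, h, ← mul_assoc]
  have e2 : (c:ℂ) * (Real.pi / (1/2:ℂ)) ^ (Module.finrank ℝ E / 2 : ℂ) = 1 := by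
    have : (Real.pi / (1/2:ℂ)) = ((2 * Real.pi : ℝ):ℂ) := by push_cast; ring
    rw [this, show (Module.finrank ℝ E / 2 : ℂ) = ((Module.finrank ℝ E / 2 : ℝ) : ℂ) by push_cast; rfl,
      ← Complex.ofReal_cpow (by positivity), ← Complex.ofReal_mul, hc, ← Real.rpow_add (by positivity)]
    have : -(Module.finrank ℝ E : ℝ)/2 + Module.finrank ℝ E / 2 = 0 := by ring
    rw [this, Real.rpow_zero]; simp
  rw [e2, one_mul]
  congr 1
  rw [I_sq]; ring

lemma integral_stdGaussian (E : Type*) [NormedAddCommGroup E] [InnerProductSpace ℝ E] [FiniteDimensional ℝ E]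
    [MeasurableSpace E] [BorelSpace E] : ∃ c : ℂ, ∀ f : E → ℂ,
    ∫ x, f x ∂(stdGaussian E) = c * ∫ x, f x * (Real.exp (-‖x‖^2/2) : ℂ) := by
  refine ⟨(((2 * Real.pi) ^ (-(Module.finrank ℝ E : ℝ) / 2) : ℝ) : ℂ), fun f => ?_⟩
  rw [stdGaussian_density, integral_withDensity_eq_integral_toReal_smul (by fun_prop) (by simp),
    ← integral_const_mul]
  congr 1; ext x
  rw [ENNReal.toReal_ofReal (by positivity), Complex.real_smul]
  push_cast; ring

lemma polar_split (E : Type*) [NormedAddCommGroup E] [InnerProductSpace ℝ E] [FiniteDimensional ℝ E]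
    [MeasurableSpace E] [BorelSpace E] [Nontrivial E] (f : E → ℂ) (hf : ∀ (r : ℝ) (x : E), 0 < r → f (r • x) = f x)
    (k : ℝ → ℂ) :
    ∫ x : E, f x * k ‖x‖ = (∫ x : Metric.sphere (0:E) 1, f x ∂(volume : Measure E).toSphere) *
      ∫ y : Set.Ioi (0:ℝ), k y ∂(Measure.volumeIoiPow (Module.finrank ℝ E - 1)) := by
  have s1 : ∫ x : E, f x * k ‖x‖ = ∫ x : ({0}ᶜ : Set E), f x * k (‖x.1‖) ∂((volume : Measure E).comap (fun x => x.1)) := by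
    have := integral_subtype_comap (μ := (volume : Measure E)) (measurableSet_singleton (0:E)).compl (fun x ↦ f x * k (‖x‖))
    rw [this, restrict_compl_singleton]
  have s2 : ∫ x : ({0}ᶜ : Set E), f x * k (‖x.1‖) ∂((volume : Measure E).comap (fun x => x.1)) =
      ∫ x, f x.1 * k x.2 ∂((volume : Measure E).toSphere.prod (.volumeIoiPow (Module.finrank ℝ E - 1))) := by
    rw [← (volume : Measure E).measurePreserving_homeomorphUnitSphereProd.integral_comp
        (Homeomorph.measurableEmbedding _) (fun x => f x.1 * k x.2)]
    congr 1; ext x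
    have hx : 0 < ‖(x:E)‖ := norm_pos_iff.2 x.2
    simp [hf _ _ (inv_pos.2 hx)]
  rw [s1, s2]
  exact integral_prod_mul (fun x : Metric.sphere (0:E) 1 => f x) (fun y : Set.Ioi (0:ℝ) => k y)

lemma gauss_indep (E : Type*) [NormedAddCommGroup E] [InnerProductSpace ℝ E] [FiniteDimensional ℝ E]
    [MeasurableSpace E] [BorelSpace E] [Nontrivial E] (f : E → ℂ) (hf : ∀ (r : ℝ) (x : E), 0 < r → f (r • x) = f x)
    (k : ℝ → ℂ) :
    ∫ x : E, f x * k ‖x‖ ∂(stdGaussian E) = (∫ x, f x ∂(stdGaussian E)) * ∫ x, k ‖x‖ ∂(stdGaussian E) := by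
  obtain ⟨c, hc⟩ := integral_stdGaussian E
  have h1 := hc (fun _ => 1)
  have p1 := polar_split E (fun _ => 1) (fun _ _ _ => rfl) (fun y => (Real.exp (-y^2/2) : ℂ))
  have p2 := polar_split E f hf (fun y => (Real.exp (-y^2/2) : ℂ))
  have p3 := polar_split E (fun _ => 1) (fun _ _ _ => rfl) (fun y => k y * (Real.exp (-y^2/2) : ℂ))
  have p4 := polar_split E f hf (fun y => k y * (Real.exp (-y^2/2) : ℂ))
  simp only [one_mul] at p1 p3
  simp only [one_mul] at h1
  rw [p1] at h1
  simp only [integral_const, probReal_univ, one_smul] at h1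
  rw [hc, hc, hc, p2, p3]
  simp_rw [mul_assoc]
  rw [p4]
  simp only [integral_const] at *
  linear_combination (c * ((∫ x : Metric.sphere (0:E) 1, f x ∂(volume : Measure E).toSphere) *
      ∫ y : Set.Ioi (0:ℝ), k y * (Real.exp (-(y:ℝ)^2/2) : ℂ) ∂(Measure.volumeIoiPow (Module.finrank ℝ E - 1)))) * h1

/-- complex chi-square moment -/
noncomputable def chiM (z : ℂ) (n : ℕ) : ℂ := 2 ^ z * (Complex.Gamma ((n:ℂ)/2 + z) / Complex.Gamma ((n:ℂ)/2))

lemma radial_int (z : ℂ) (hz : z.re = 0) (n : ℕ) (hn : 0 < n) :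
    ∫ y in Set.Ioi (0:ℝ), y^(n-1) • (Complex.exp (z * Real.log (y^2)) * (Real.exp (-y^2/2) : ℂ)) =
    1/2 * (2 ^ ((n:ℂ)/2 + z) * Complex.Gamma ((n:ℂ)/2 + z)) := by
  have h := Complex.integral_cpow_mul_exp_neg_mul_Ioi (a := (n:ℂ)/2 + z) (r := 1/2) (by simp [hz, hn]) (by norm_num)
  have h2 := integral_comp_rpow_Ioi_of_pos (g := fun s : ℝ => (1/2 : ℂ) * ((s:ℂ)^((n:ℂ)/2 + z - 1) * Complex.exp (-((1/2 : ℝ) * s)))) (p := 2) (by norm_num)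
  rw [integral_const_mul, h] at h2
  norm_num at h2 ⊢
  rw [← h2]
  apply setIntegral_congr_fun measurableSet_Ioi
  intro y hy
  have hy : 0 < y := hy
  have hyc : (y:ℂ) ≠ 0 := by exact_mod_cast hy.ne'
  simp only
  have e1 : ((y:ℂ)^2) ^ ((n:ℂ)/2 + z - 1) = Complex.exp (z * (2 * Real.log y)) * (y:ℂ)^n / y^2 := by
    rw [Complex.cpow_def_of_ne_zero (pow_ne_zero _ hyc), eq_div_iff (pow_ne_zero _ hyc)]
    have e0 : Complex.log ((y:ℂ)^2) = 2 * Real.log y := by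
      rw [← Complex.ofReal_pow, ← Complex.ofReal_log (by positivity), Real.log_pow]; push_cast; rfl
    have ey : ∀ m : ℕ, (y:ℂ)^m = Complex.exp (m * Real.log y) := by
      intro m
      rw [Complex.exp_nat_mul, ← Complex.ofReal_exp, Real.exp_log hy]
    rw [e0, ey, ey, ← Complex.exp_add, ← Complex.exp_add]
    congr 1; push_cast; ring
  rw [e1]
  obtain ⟨m, rfl⟩ : ∃ m, n = m + 1 := ⟨n - 1, by omega⟩
  simp only [Nat.add_sub_cancel]
  have e3 : Complex.exp (-(y:ℂ)^2/2) = Complex.exp (-(1/2 * y^2)) := by congr 1; ring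
  rw [e3]
  field_simp
  ring

lemma chi_full (z : ℂ) (hz : z.re = 0) (E : Type*) [NormedAddCommGroup E] [InnerProductSpace ℝ E] [FiniteDimensional ℝ E]
    [MeasurableSpace E] [BorelSpace E] [Nontrivial E] :
    ∫ x : E, Complex.exp (z * Real.log (‖x‖^2)) ∂(stdGaussian E) = chiM z (Module.finrank ℝ E) := by
  obtain ⟨c, hc⟩ := integral_stdGaussian E
  have hn : 0 < Module.finrank ℝ E := Module.finrank_pos
  have a1 := integral_fun_norm_addHaar (volume : Measure E) (fun y => Complex.exp (z * Real.log (y^2)) * (Real.exp (-y^2/2) : ℂ))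
  have a0 := integral_fun_norm_addHaar (volume : Measure E) (fun y => Complex.exp (0 * Real.log (y^2)) * (Real.exp (-y^2/2) : ℂ))
  rw [radial_int z hz _ hn] at a1
  rw [radial_int 0 rfl _ hn] at a0
  have h0 := hc (fun x => Complex.exp (0 * Real.log (‖x‖^2)))
  rw [a0] at h0
  rw [hc, a1, chiM]
  simp only [zero_mul, Complex.exp_zero, integral_const, probReal_univ, one_smul, add_zero] at h0
  have hG : Complex.Gamma ((Module.finrank ℝ E : ℂ)/2) ≠ 0 := Complex.Gamma_ne_zero_of_re_pos (by simp [hn])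
  rw [Complex.cpow_add _ _ (by norm_num)]
  rw [eq_comm]
  calc _ = (2 ^ z * (Complex.Gamma ((Module.finrank ℝ E : ℂ)/2 + z) / Complex.Gamma ((Module.finrank ℝ E : ℂ)/2))) * 1 := by rw [mul_one]
    _ = _ := by
      refine (congrArg (fun w => _ * w) h0).trans ?_
      simp only [nsmul_eq_mul, Complex.real_smul]
      generalize Complex.Gamma ((Module.finrank ℝ E : ℂ)/2 + z) = G1
      field_simp

end GaussDensity

/-- standard Gaussian product measure -/
noncomputable def gpi (ι : Type) [Fintype ι] : Measure (ι → ℝ) := Measure.pi (fun _ : ι => gaussianReal 0 1)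

instance (ι : Type) [Fintype ι] : IsProbabilityMeasure (gpi ι) := by unfold gpi; infer_instance

lemma gpi_marg {ι : Type} [Fintype ι] (S : Finset ι) (φ : (S → ℝ) → ℂ) (hφ : Measurable φ) :
    ∫ x, φ (S.restrict x) ∂(gpi ι) = ∫ y, φ y ∂(gpi S) := by
  unfold gpi
  rw [← Measure.infinitePi_eq_pi (μ := fun _ : ι => gaussianReal 0 1)]
  exact integral_restrict_infinitePi (μ := fun _ : ι => gaussianReal 0 1) hφ.aestronglyMeasurable

lemma gpi_sum_pos {ι : Type} [Fintype ι] (S : Finset ι) (hS : S.Nonempty) :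
    ∀ᵐ x ∂(gpi ι), 0 < ∑ i ∈ S, x i ^ 2 := by
  obtain ⟨i, hi⟩ := hS
  have : ∀ᵐ x ∂(gpi ι), x i ≠ 0 := by
    have : NullSingletonClass (gaussianReal (0:ℝ) 1) := nullSingletonClass_gaussianReal one_ne_zero
    exact Measure.ae_eval_ne (μ := fun _ : ι => gaussianReal 0 1) i 0
  filter_upwards [this] with x hx
  exact lt_of_lt_of_le (by positivity) (Finset.single_le_sum (f := fun i => x i^2) (fun _ _ => sq_nonneg _) hi)

lemma gpi_euclid {ι : Type} [Fintype ι] (φ : EuclideanSpace ℝ ι → ℂ) (hφ : Measurable φ) :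
    ∫ x, φ x ∂(stdGaussian (EuclideanSpace ℝ ι)) = ∫ x, φ (WithLp.toLp 2 x) ∂(gpi ι) := by
  rw [← map_pi_eq_stdGaussian, integral_map (by fun_prop) hφ.aestronglyMeasurable]
  rfl

lemma chi_univ (z : ℂ) (hz : z.re = 0) (κ : Type) [Fintype κ] [Nonempty κ] :
    ∫ x : κ → ℝ, Complex.exp (z * Real.log (∑ i, x i ^ 2)) ∂(gpi κ) = chiM z (Fintype.card κ) := by
  have h := chi_full z hz (EuclideanSpace ℝ κ)
  rw [gpi_euclid _ (by fun_prop), finrank_euclideanSpace] at h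
  rw [← h]
  congr 1; ext x
  rw [EuclideanSpace.real_norm_sq_eq]

lemma chi_S (z : ℂ) (hz : z.re = 0) {ι : Type} [Fintype ι] (S : Finset ι) (hS : S.Nonempty) :
    ∫ x : ι → ℝ, Complex.exp (z * Real.log (∑ i ∈ S, x i ^ 2)) ∂(gpi ι) = chiM z S.card := by
  haveI : Nonempty S := hS.to_subtype
  have h := chi_univ z hz S
  rw [Fintype.card_coe] at h
  rw [← h, ← gpi_marg S _ (by fun_prop)]
  congr 1; ext x
  rw [← Finset.sum_coe_sort S]; rfl

lemma chiM_ne {z : ℂ} (hz : z.re = 0) {n : ℕ} (hn : 0 < n) : chiM z n ≠ 0 := by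
  rw [chiM]
  refine mul_ne_zero (by simp [Complex.cpow_eq_zero_iff]) (div_ne_zero ?_ ?_) <;>
  exact Complex.Gamma_ne_zero_of_re_pos (by simp [hz, hn])

lemma ratio_univ (z : ℂ) (hz : z.re = 0) {κ : Type} [Fintype κ] (S : Finset κ) (hS : S.Nonempty) :
    ∫ x : κ → ℝ, Complex.exp (z * Real.log ((∑ i ∈ S, x i ^ 2) / ∑ i, x i ^ 2)) ∂(gpi κ) =
      chiM z S.card / chiM z (Fintype.card κ) := by
  haveI : Nonempty κ := ⟨hS.choose⟩
  have h := gauss_indep (EuclideanSpace ℝ κ) (fun x => Complex.exp (z * Real.log ((∑ i ∈ S, x i ^ 2) / ‖x‖^2)))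
    (by
      intro r x hr
      simp only [PiLp.smul_apply, smul_eq_mul, norm_smul, mul_pow, ← Finset.mul_sum, Real.norm_eq_abs, sq_abs]
      rw [mul_div_mul_left _ _ (by positivity)])
    (fun y => Complex.exp (z * Real.log (y^2)))
  rw [chi_full z hz, finrank_euclideanSpace, gpi_euclid _ (by fun_prop), gpi_euclid _ (by fun_prop)] at h
  simp only [EuclideanSpace.real_norm_sq_eq] at h
  rw [eq_div_iff (chiM_ne hz Fintype.card_pos), ← h, ← chi_S z hz S hS]
  apply integral_congr_ae
  filter_upwards [gpi_sum_pos S hS, gpi_sum_pos (Finset.univ : Finset κ) Finset.univ_nonempty] with x h1 h2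
  rw [← Complex.exp_add, Real.log_div h1.ne' h2.ne']
  congr 1; push_cast; ring

lemma ratio_S (z : ℂ) (hz : z.re = 0) {ι : Type} [Fintype ι] (S U : Finset ι) (hS : S.Nonempty) (hSU : S ⊆ U) :
    ∫ x : ι → ℝ, Complex.exp (z * Real.log ((∑ i ∈ S, x i ^ 2) / ∑ i ∈ U, x i ^ 2)) ∂(gpi ι) =
      chiM z S.card / chiM z U.card := by
  have hc : (S.subtype (· ∈ U)).card = S.card := by
    rw [Finset.card_subtype, Finset.filter_true_of_mem hSU]
  have hne : (S.subtype (· ∈ U)).Nonempty := by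
    rw [← Finset.card_pos, hc]; exact hS.card_pos
  have h := ratio_univ z hz (S.subtype (· ∈ U)) hne
  rw [hc, Fintype.card_coe] at h
  rw [← h, ← gpi_marg U _ (by fun_prop)]
  congr 1; ext x
  have e1 : ∑ i ∈ S.subtype (· ∈ U), (U.restrict x) i ^ 2 = ∑ i ∈ S, x i ^ 2 := by
    have := Finset.sum_subtype_of_mem (s := S) (p := (· ∈ U)) (fun i => x i ^ 2) hSU
    rw [← this]; rfl
  have e2 : ∑ i, (U.restrict x) i ^ 2 = ∑ i ∈ U, x i ^ 2 := by
    rw [← Finset.sum_coe_sort U]; rfl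
  rw [e1, e2]

lemma gpi_orth {ι : Type} [Fintype ι] (U : Matrix ι ι ℝ) (hU : Uᵀ * U = 1) :
    MeasurePreserving (fun x : ι → ℝ => U *ᵥ x) (gpi ι) (gpi ι) := by
  have hU' : U * Uᵀ = 1 := mul_eq_one_comm.mp hU
  have hm : Measurable (fun x : ι → ℝ => U *ᵥ x) := by
    refine measurable_pi_lambda _ fun i => ?_
    simp only [mulVec, dotProduct]; fun_prop
  refine ⟨hm, ?_⟩
  let f : EuclideanSpace ℝ ι ≃ₗ[ℝ] EuclideanSpace ℝ ι :=
    { toFun := fun x => WithLp.toLp 2 (U *ᵥ (WithLp.ofLp x))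
      invFun := fun x => WithLp.toLp 2 (Uᵀ *ᵥ (WithLp.ofLp x))
      map_add' := fun x y => by ext i; simp [mulVec_add]
      map_smul' := fun c x => by ext i; simp [mulVec_smul]
      left_inv := fun x => by simp [mulVec_mulVec, hU]
      right_inv := fun x => by simp [mulVec_mulVec, hU'] }
  let g : EuclideanSpace ℝ ι ≃ₗᵢ[ℝ] EuclideanSpace ℝ ι := ⟨f, fun x => by
    rw [← sq_eq_sq₀ (norm_nonneg _) (norm_nonneg _), EuclideanSpace.real_norm_sq_eq, EuclideanSpace.real_norm_sq_eq]
    have : (U *ᵥ (WithLp.ofLp x)) ⬝ᵥ (U *ᵥ (WithLp.ofLp x)) = (WithLp.ofLp x) ⬝ᵥ (WithLp.ofLp x) := by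
      rw [dotProduct_mulVec, vecMul_mulVec, hU, vecMul_one]
    simpa [dotProduct, pow_two, f] using this⟩
  have h := stdGaussian_map g
  rw [← map_pi_eq_stdGaussian, Measure.map_map (by fun_prop) (by fun_prop)] at h
  have h2 := congrArg (fun μ => μ.map (WithLp.ofLp (p := 2) (V := ι → ℝ))) h
  rw [Measure.map_map (by fun_prop) (by fun_prop), Measure.map_map (by fun_prop) (by fun_prop)] at h2
  have e : (WithLp.ofLp (p := 2) (V := ι → ℝ)) ∘ (WithLp.toLp 2) = id := rfl
  rw [e, Measure.map_id] at h2
  exact h2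

lemma two_proj {ι : Type} [Fintype ι] (P Q : Matrix ι ι ℝ) (hP : Pᵀ = P) (hPP : P * P = P)
    (hQ : Qᵀ = Q) (hQQ : Q * Q = Q) (hPQ : P * Q = P) (hQP : Q * P = P) :
    ∃ (U : Matrix ι ι ℝ) (S T : Finset ι), Uᵀ * U = 1 ∧ S ⊆ T ∧
      P = Uᵀ * diagonal (fun i => if i ∈ S then 1 else 0) * U ∧
      Q = Uᵀ * diagonal (fun i => if i ∈ T then 1 else 0) * U := by
  have hA : (P + Q).IsHermitian := by
    rw [Matrix.IsHermitian, conjTranspose_eq_transpose_of_trivial, transpose_add, hP, hQ]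
  set W : Matrix ι ι ℝ := (hA.eigenvectorUnitary).1 with hW
  have hW1 : Wᵀ * W = 1 := by
    have := Unitary.coe_star_mul_self hA.eigenvectorUnitary
    rwa [← hW, star_eq_conjTranspose, conjTranspose_eq_transpose_of_trivial] at this
  have hW2 : W * Wᵀ = 1 := mul_eq_one_comm.mp hW1
  set l := hA.eigenvalues
  have hsp : P + Q = W * diagonal l * Wᵀ := by
    have := hA.spectral_theorem
    rw [Unitary.conjStarAlgAut_apply] at this
    rw [← hW, star_eq_conjTranspose, conjTranspose_eq_transpose_of_trivial] at this
    exact this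
  have hAA : (P + Q) * (P + Q) = W * diagonal (fun i => l i * l i) * Wᵀ := by
    rw [hsp]
    calc _ = W * diagonal l * (Wᵀ * W) * diagonal l * Wᵀ := by simp only [Matrix.mul_assoc]
      _ = _ := by rw [hW1, Matrix.mul_one, Matrix.mul_assoc W, diagonal_mul_diagonal]
  have hAA' : (P + Q) * (P + Q) = (2:ℝ) • P + (P + Q) := by
    rw [Matrix.add_mul, Matrix.mul_add, Matrix.mul_add, hPP, hPQ, hQP, hQQ, two_smul]
  have key : ∀ (M : Matrix ι ι ℝ) (a : ι → ℝ), M = W * diagonal a * Wᵀ → Wᵀ * M * W = diagonal a := by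
    intro M a h
    rw [h]
    calc _ = (Wᵀ * W) * diagonal a * (Wᵀ * W) := by simp only [Matrix.mul_assoc]
      _ = _ := by rw [hW1]; simp
  set a : ι → ℝ := fun i => (l i * l i - l i) / 2
  set b : ι → ℝ := fun i => l i - a i
  have ePa : P = W * diagonal a * Wᵀ := by
    have : P = (1/2:ℝ) • ((P + Q) * (P + Q) - (P+Q)) := by rw [hAA']; simp
    rw [this, hAA, hsp, ← Matrix.sub_mul, ← Matrix.mul_sub, diagonal_sub, ← Matrix.smul_mul, ← Matrix.mul_smul, ← diagonal_smul]
    congr 3; ext i; simp [a]; ring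
  have eQb : Q = W * diagonal b * Wᵀ := by
    have : Q = (P + Q) - P := by simp
    rw [this, hsp, ePa, ← Matrix.sub_mul, ← Matrix.mul_sub, diagonal_sub]
  have mulk : ∀ a b : ι → ℝ, (W * diagonal a * Wᵀ) * (W * diagonal b * Wᵀ) = W * diagonal (fun i => a i * b i) * Wᵀ := by
    intro a b
    calc _ = W * diagonal a * (Wᵀ * W) * diagonal b * Wᵀ := by simp only [Matrix.mul_assoc]
      _ = _ := by rw [hW1, Matrix.mul_one, Matrix.mul_assoc W, diagonal_mul_diagonal]
  have inj : ∀ a b : ι → ℝ, W * diagonal a * Wᵀ = W * diagonal b * Wᵀ → a = b := by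
    intro a b h
    have h1 := key _ _ h
    rw [key _ a rfl] at h1
    exact diagonal_injective h1
  have ha : ∀ i, a i * a i = a i := by
    have h := hPP; rw [ePa, mulk] at h; exact congrFun (inj _ _ h)
  have hb : ∀ i, b i * b i = b i := by
    have h := hQQ; rw [eQb, mulk] at h; exact congrFun (inj _ _ h)
  have hab : ∀ i, a i * b i = a i := by
    have h := hPQ; rw [ePa, eQb, mulk] at h; exact congrFun (inj _ _ h)
  have z1 : ∀ x : ℝ, x * x = x → x = if x = 1 then 1 else 0 := by
    intro x hx
    have h0 : x * (x - 1) = 0 := by linarith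
    rcases mul_eq_zero.mp h0 with h | h
    · simp [h]
    · have : x = 1 := by linarith
      simp [this]
  refine ⟨Wᵀ, Finset.univ.filter (fun i => a i = 1), Finset.univ.filter (fun i => b i = 1), ?_, ?_, ?_, ?_⟩
  · rw [transpose_transpose, hW2]
  · intro i hi
    simp only [Finset.mem_filter, Finset.mem_univ, true_and] at hi ⊢
    have := hab i; rw [hi] at this; linarith
  · rw [transpose_transpose]
    simp only [Finset.mem_filter, Finset.mem_univ, true_and]
    have : a = fun i => if a i = 1 then 1 else 0 := funext fun i => z1 _ (ha i)
    rw [← this]; exact ePa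
  · rw [transpose_transpose]
    simp only [Finset.mem_filter, Finset.mem_univ, true_and]
    have : b = fun i => if b i = 1 then 1 else 0 := funext fun i => z1 _ (hb i)
    rw [← this]; exact eQb

lemma proj_ratio (z : ℂ) (hz : z.re = 0) {ι : Type} [Fintype ι] (P Q : Matrix ι ι ℝ) (hP : Pᵀ = P) (hPP : P * P = P)
    (hQ : Qᵀ = Q) (hQQ : Q * Q = Q) (hPQ : P * Q = P) (hQP : Q * P = P) (s t : ℕ) (hs : P.trace = s) (ht : Q.trace = t)
    (hs0 : 0 < s) :
    (∀ᵐ x ∂(gpi ι), 0 < x ⬝ᵥ (P *ᵥ x) ∧ 0 < x ⬝ᵥ (Q *ᵥ x)) ∧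
    ∫ x, Complex.exp (z * Real.log ((x ⬝ᵥ (P *ᵥ x)) / (x ⬝ᵥ (Q *ᵥ x)))) ∂(gpi ι) = chiM z s / chiM z t := by
  obtain ⟨U, S, T, hU, hST, eP, eQ⟩ := two_proj P Q hP hPP hQ hQQ hPQ hQP
  have hU' : U * Uᵀ = 1 := mul_eq_one_comm.mp hU
  have tr : ∀ S : Finset ι, (Uᵀ * diagonal (fun i => if i ∈ S then (1:ℝ) else 0) * U).trace = S.card := by
    intro S
    rw [Matrix.mul_assoc, Matrix.trace_mul_comm, Matrix.mul_assoc, hU', Matrix.mul_one, trace_diagonal]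
    simp
  have qf : ∀ (S : Finset ι) (x : ι → ℝ), x ⬝ᵥ ((Uᵀ * diagonal (fun i => if i ∈ S then (1:ℝ) else 0) * U) *ᵥ x)
      = ∑ i ∈ S, (U *ᵥ x) i ^ 2 := by
    intro S x
    rw [← mulVec_mulVec, ← mulVec_mulVec, dotProduct_mulVec, vecMul_transpose]
    simp only [dotProduct, mulVec_diagonal]
    simp [pow_two]
  have cS : S.card = s := by
    have := tr S; rw [← eP, hs] at this; exact_mod_cast this.symm
  have cT : T.card = t := by
    have := tr T; rw [← eQ, ht] at this; exact_mod_cast this.symm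
  have hS : S.Nonempty := by rw [← Finset.card_pos, cS]; exact hs0
  have mp := gpi_orth U hU
  simp only [eP, eQ, qf]
  constructor
  · have h1 := mp.quasiMeasurePreserving.ae (gpi_sum_pos S hS)
    have h2 := mp.quasiMeasurePreserving.ae (gpi_sum_pos T (hS.mono hST))
    filter_upwards [h1, h2] with x a b using ⟨a, b⟩
  · rw [← cS, ← cT, ← ratio_S z hz S T hS hST]
    conv_rhs => rw [← mp.map_eq]
    rw [integral_map mp.measurable.aemeasurable (Measurable.aestronglyMeasurable (by fun_prop))]

noncomputable def ddet {k : ℕ} {ι : Type} [Fintype ι] (E : Matrix ι ι ℝ) (G : Fin k → ι → ℝ) : ℝ :=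
  (Matrix.of G * E * (Matrix.of G)ᵀ).det

noncomputable def pj {k : ℕ} {ι : Type} [Fintype ι] (E : Matrix ι ι ℝ) (G : Fin k → ι → ℝ) : Matrix ι ι ℝ :=
  E - E * (Matrix.of G)ᵀ * (Matrix.of G * E * (Matrix.of G)ᵀ)⁻¹ * Matrix.of G * E

lemma pj_trans {k : ℕ} {ι : Type} [Fintype ι] (E : Matrix ι ι ℝ) (hE : Eᵀ = E) (G : Fin k → ι → ℝ) :
    (pj E G)ᵀ = pj E G := by
  simp only [pj, transpose_sub, transpose_mul, transpose_nonsing_inv, transpose_transpose, hE, Matrix.mul_assoc]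

lemma pj_mulE {k : ℕ} {ι : Type} [Fintype ι] (E : Matrix ι ι ℝ) (hEE : E * E = E) (G : Fin k → ι → ℝ) :
    pj E G * E = pj E G := by
  simp only [pj, Matrix.sub_mul, Matrix.mul_assoc, hEE]

lemma pj_mulG {k : ℕ} {ι : Type} [Fintype ι] (E : Matrix ι ι ℝ) (hEE : E * E = E) (G : Fin k → ι → ℝ)
    (hd : ddet E G ≠ 0) : pj E G * (Matrix.of G)ᵀ = 0 := by
  have hu : IsUnit (Matrix.of G * E * (Matrix.of G)ᵀ).det := isUnit_iff_ne_zero.mpr hd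
  rw [pj, Matrix.sub_mul]
  have : E * (Matrix.of G)ᵀ * (Matrix.of G * E * (Matrix.of G)ᵀ)⁻¹ * Matrix.of G * E * (Matrix.of G)ᵀ
    = E * (Matrix.of G)ᵀ * ((Matrix.of G * E * (Matrix.of G)ᵀ)⁻¹ * (Matrix.of G * E * (Matrix.of G)ᵀ)) := by
    simp only [Matrix.mul_assoc]
  rw [this, nonsing_inv_mul _ hu, Matrix.mul_one, sub_self]

lemma pj_mul_one {k : ℕ} {ι : Type} [Fintype ι] (E : Matrix ι ι ℝ) (hEE : E * E = E) (G : Fin k → ι → ℝ)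
    (hd : ddet E G ≠ 0) : pj E G * pj 1 G = pj E G := by
  have := pj_mulG E hEE G hd
  conv_lhs => rw [pj.eq_1 1]
  simp only [Matrix.mul_sub, Matrix.mul_one, Matrix.one_mul, ← Matrix.mul_assoc, this, Matrix.zero_mul, sub_zero]

lemma pj_idem {k : ℕ} {ι : Type} [Fintype ι] (E : Matrix ι ι ℝ) (hEE : E * E = E) (G : Fin k → ι → ℝ)
    (hd : ddet E G ≠ 0) : pj E G * pj E G = pj E G := by
  have := pj_mulG E hEE G hd
  have h2 := pj_mulE E hEE G
  conv_lhs => enter [2]; rw [pj]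
  rw [Matrix.mul_sub, h2]
  simp only [← Matrix.mul_assoc, h2, this, Matrix.zero_mul, sub_zero]

lemma pj_trace {k : ℕ} {ι : Type} [Fintype ι] (E : Matrix ι ι ℝ) (hEE : E * E = E) (G : Fin k → ι → ℝ)
    (hd : ddet E G ≠ 0) : (pj E G).trace = E.trace - k := by
  have hu : IsUnit (Matrix.of G * E * (Matrix.of G)ᵀ).det := isUnit_iff_ne_zero.mpr hd
  rw [pj, trace_sub, Matrix.mul_assoc _ (Matrix.of G) E, Matrix.trace_mul_comm]
  have : Matrix.of G * E * (E * (Matrix.of G)ᵀ * (Matrix.of G * E * (Matrix.of G)ᵀ)⁻¹)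
    = (Matrix.of G * E * (Matrix.of G)ᵀ) * (Matrix.of G * E * (Matrix.of G)ᵀ)⁻¹ := by
    rw [← Matrix.mul_assoc, ← Matrix.mul_assoc, Matrix.mul_assoc _ E E, hEE]
  rw [this, mul_nonsing_inv _ hu, trace_one, Fintype.card_fin]

lemma det_succ_schur {k : ℕ} (M : Matrix (Fin (k+1)) (Fin (k+1)) ℝ) (hD : (M.submatrix Fin.succ Fin.succ).det ≠ 0) :
    M.det = (M.submatrix Fin.succ Fin.succ).det *
      (M 0 0 - (fun j => M 0 (Fin.succ j)) ⬝ᵥ ((M.submatrix Fin.succ Fin.succ)⁻¹ *ᵥ (fun j => M (Fin.succ j) 0))) := by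
  let e : Unit ⊕ Fin k ≃ Fin (k+1) :=
    (Equiv.sumComm _ _).trans ((Equiv.optionEquivSumPUnit (Fin k)).symm.trans (finSuccEquiv k).symm)
  have hD' : IsUnit (M.submatrix Fin.succ Fin.succ) := (isUnit_iff_isUnit_det _).mpr (isUnit_iff_ne_zero.mpr hD)
  let _ := hD'.invertible
  have h : M.submatrix e e = fromBlocks (Matrix.of fun _ _ => M 0 0) (Matrix.of fun _ j => M 0 (Fin.succ j))
      (Matrix.of fun i _ => M (Fin.succ i) 0) (M.submatrix Fin.succ Fin.succ) := by
    ext i j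
    rcases i with i | i <;> rcases j with j | j <;> simp [e]
  rw [← det_submatrix_equiv_self e M, h, det_fromBlocks₂₂, det_unique (n := Unit), invOf_eq_nonsing_inv]
  congr 1
  rw [Matrix.mul_assoc]
  simp [Matrix.mul_apply, dotProduct, mulVec]

lemma ddet_succ {k : ℕ} {ι : Type} [Fintype ι] (E : Matrix ι ι ℝ) (hE : Eᵀ = E) (hEE : E * E = E) (g : ι → ℝ) (G : Fin k → ι → ℝ)
    (hd : ddet E G ≠ 0) : ddet E (Fin.cons g G : Fin (k+1) → ι → ℝ) = ddet E G * (g ⬝ᵥ (pj E G *ᵥ g)) := by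
  set M := Matrix.of (Fin.cons g G : Fin (k+1) → ι → ℝ) * E * (Matrix.of (Fin.cons g G : Fin (k+1) → ι → ℝ))ᵀ with hM
  have hsub : M.submatrix Fin.succ Fin.succ = Matrix.of G * E * (Matrix.of G)ᵀ := by
    ext i j; simp [hM, Matrix.mul_apply]
  rw [ddet, ← hM, det_succ_schur M (by rw [hsub]; exact hd), hsub]
  have h00 : M 0 0 = g ⬝ᵥ (E *ᵥ g) := by
    rw [dotProduct_mulVec]
    simp [hM, Matrix.mul_apply, vecMul, dotProduct]
  have h1 : (fun j => M (Fin.succ j) 0) = Matrix.of G *ᵥ (E *ᵥ g) := by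
    ext j
    rw [mulVec_mulVec]
    simp [hM, Matrix.mul_apply, mulVec, dotProduct]
  have h2 : (fun j => M 0 (Fin.succ j)) = Matrix.of G *ᵥ (E *ᵥ g) := by
    have : Mᵀ = M := by simp [hM, transpose_mul, hE, Matrix.mul_assoc]
    rw [← h1]; ext j
    rw [← transpose_apply M, this]
  rw [h00, h1, h2]
  congr 1
  rw [pj, sub_mulVec, dotProduct_sub]
  congr 1
  simp only [← mulVec_mulVec]
  conv_rhs => rw [dotProduct_mulVec, ← mulVec_transpose, hE, dotProduct_mulVec, vecMul_transpose]

lemma ddet_meas {k : ℕ} {ι : Type} [Fintype ι] (E : Matrix ι ι ℝ) :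
    Measurable (fun G : Fin k → ι → ℝ => ddet E G) := by
  have : Continuous (fun G : Fin k → ι → ℝ => ddet E G) := by
    unfold ddet
    have hc : Continuous (fun G : Fin k → ι → ℝ => (Matrix.of G : Matrix (Fin k) ι ℝ)) := continuous_id
    exact Continuous.matrix_det ((hc.matrix_mul continuous_const).matrix_mul hc.matrix_transpose)
  exact this.measurable

lemma cons_mp (k : ℕ) (ι : Type) [Fintype ι] :
    MeasurePreserving (fun x : (Fin k → ι → ℝ) × (ι → ℝ) => (Fin.cons x.2 x.1 : Fin (k+1) → ι → ℝ))
      ((Measure.pi (fun _ : Fin k => gpi ι)).prod (gpi ι)) (Measure.pi (fun _ : Fin (k+1) => gpi ι)) := by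
  have h1 := (measurePreserving_piFinSuccAbove (fun _ : Fin (k+1) => gpi ι) 0).symm
  have h2 := h1.comp (Measure.measurePreserving_swap (μ := Measure.pi (fun _ : Fin k => gpi ι)) (ν := gpi ι))
  convert h2 using 1
  funext x
  simp [MeasurableEquiv.piFinSuccAbove, Fin.insertNthEquiv, Fin.insertNth_zero]

lemma rows (z : ℂ) (hz : z.re = 0) {ι : Type} [Fintype ι] (E : Matrix ι ι ℝ) (hE : Eᵀ = E) (hEE : E * E = E)
    (r : ℕ) (htr : E.trace = r) (hrN : r ≤ Fintype.card ι) (k : ℕ) (hk : k ≤ r) :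
    (∀ᵐ G ∂(Measure.pi (fun _ : Fin k => gpi ι)), 0 < ddet E G ∧ 0 < ddet 1 G) ∧
    ∫ G, Complex.exp (z * Real.log (ddet E G / ddet 1 G)) ∂(Measure.pi (fun _ : Fin k => gpi ι)) =
      ∏ j ∈ Finset.range k, chiM z (r - j : ℕ) / chiM z (Fintype.card ι - j : ℕ) := by
  induction k with
  | zero => simp [ddet]
  | succ k ih =>
    obtain ⟨ih1, ih2⟩ := ih (by omega)
    have step : ∀ G : Fin k → ι → ℝ, 0 < ddet E G ∧ 0 < ddet 1 G →
        (∀ᵐ g ∂(gpi ι), 0 < ddet E (Fin.cons g G : Fin (k+1) → ι → ℝ) ∧ 0 < ddet 1 (Fin.cons g G : Fin (k+1) → ι → ℝ)) ∧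
        ∫ g, Complex.exp (z * Real.log (ddet E (Fin.cons g G : Fin (k+1) → ι → ℝ) / ddet 1 (Fin.cons g G : Fin (k+1) → ι → ℝ))) ∂(gpi ι) =
          Complex.exp (z * Real.log (ddet E G / ddet 1 G)) * (chiM z (r - k : ℕ) / chiM z (Fintype.card ι - k : ℕ)) := by
      intro G hG
      have d1 := hG.1.ne'
      have d2 := hG.2.ne'
      have e1 := pj_mul_one E hEE G d1
      have t1 := pj_trans E hE G
      have t2 := pj_trans (1 : Matrix ι ι ℝ) transpose_one G
      have e2 : pj 1 G * pj E G = pj E G := by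
        have := congrArg transpose e1
        rwa [transpose_mul, t1, t2] at this
      obtain ⟨a1, a2⟩ := proj_ratio z hz (pj E G) (pj 1 G) t1 (pj_idem E hEE G d1)
        t2 (pj_idem 1 (Matrix.one_mul 1) G d2) e1 e2 (r - k) (Fintype.card ι - k)
        (by rw [pj_trace E hEE G d1, htr, Nat.cast_sub (by omega)])
        (by rw [pj_trace 1 (Matrix.one_mul 1) G d2, trace_one, Nat.cast_sub (by omega)]) (by omega)
      simp only [ddet_succ E hE hEE _ G d1, ddet_succ 1 transpose_one (Matrix.one_mul 1) _ G d2]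
      constructor
      · filter_upwards [a1] with g hg
        exact ⟨mul_pos hG.1 hg.1, mul_pos hG.2 hg.2⟩
      · rw [← a2, ← integral_const_mul]
        apply integral_congr_ae
        filter_upwards [a1] with g hg
        rw [← Complex.exp_add, mul_div_mul_comm, Real.log_mul (div_pos hG.1 hG.2).ne' (div_pos hg.1 hg.2).ne']
        congr 1; push_cast; ring
    have mp := cons_mp k ι
    have hm : MeasurableSet {G : Fin (k+1) → ι → ℝ | 0 < ddet E G ∧ 0 < ddet 1 G} :=
      (measurableSet_lt measurable_const (ddet_meas E)).inter (measurableSet_lt measurable_const (ddet_meas 1))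
    have hF : Measurable (fun G : Fin (k+1) → ι → ℝ => Complex.exp (z * Real.log (ddet E G / ddet 1 G))) := by
      have := ddet_meas (k := k+1) E
      have := ddet_meas (k := k+1) (1 : Matrix ι ι ℝ)
      fun_prop
    constructor
    · rw [← mp.map_eq, ae_map_iff mp.measurable.aemeasurable hm]
      have := (Measure.ae_prod_mem_iff_ae_ae_mem (μ := Measure.pi (fun _ : Fin k => gpi ι)) (ν := gpi ι) (mp.measurable hm)).mpr
        (by filter_upwards [ih1] with G hG using (step G hG).1)
      exact this
    · rw [← mp.map_eq, integral_map mp.measurable.aemeasurable hF.aestronglyMeasurable, integral_prod]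
      · rw [Finset.prod_range_succ, ← ih2, ← integral_mul_const]
        apply integral_congr_ae
        filter_upwards [ih1] with G hG using (step G hG).2
      · refine Integrable.of_bound (hF.comp mp.measurable).aestronglyMeasurable 1 (ae_of_all _ fun x => ?_)
        rw [Complex.norm_exp]
        simp [hz]

lemma law_curry {Ω : Type} [MeasurableSpace Ω] (μ : Measure Ω) [IsProbabilityMeasure μ] {p : ℕ} {ι : Type} [Fintype ι]
    (X : Fin p × ι → Ω → ℝ) (hX : ∀ i, Measurable (X i)) (hi : iIndepFun X μ)
    (hl : ∀ i, μ.map (X i) = gaussianReal 0 1) :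
    μ.map (fun ω i j => X (i, j) ω) = Measure.pi (fun _ : Fin p => gpi ι) := by
  have h := hi.map_fun_eq_pi_map (fun i => (hX i).aemeasurable)
  simp only [hl] at h
  have h2 := congrArg (fun ν => ν.map (MeasurableEquiv.curry (Fin p) ι ℝ)) h
  rw [← Measure.infinitePi_eq_pi (μ := fun _ : Fin p × ι => gaussianReal 0 1)] at h2
  have h3 := Measure.infinitePi_map_curry (ι := Fin p) (κ := ι) (μ := fun _ _ => gaussianReal 0 1)
  rw [h3, Measure.map_map (by fun_prop) (by fun_prop)] at h2
  simp only [Measure.infinitePi_eq_pi] at h2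
  exact h2

noncomputable def maskE (r q : ℕ) : Matrix (Fin r ⊕ Fin q) (Fin r ⊕ Fin q) ℝ :=
  diagonal (Sum.elim (fun _ => 1) (fun _ => 0))

lemma maskE_t (r q : ℕ) : (maskE r q)ᵀ = maskE r q := diagonal_transpose _
lemma maskE_i (r q : ℕ) : maskE r q * maskE r q = maskE r q := by
  rw [maskE, diagonal_mul_diagonal]; congr 1; ext i; rcases i with i | i <;> simp
lemma maskE_tr (r q : ℕ) : (maskE r q).trace = r := by simp [maskE, trace_diagonal]

lemma ddet_mask {p r q : ℕ} (H : Matrix (Fin p) (Fin r) ℝ) (Ξ : Matrix (Fin p) (Fin q) ℝ) :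
    ddet (maskE r q) (fun i j => Sum.elim (H i) (Ξ i) j) = (H * Hᵀ).det := by
  rw [ddet]; congr 1
  ext i j
  rw [maskE, Matrix.mul_apply]
  simp only [mul_diagonal, Fintype.sum_sum_type]
  simp [Matrix.mul_apply]

lemma ddet_one {p r q : ℕ} [DecidableEq (Fin r ⊕ Fin q)] (H : Matrix (Fin p) (Fin r) ℝ) (Ξ : Matrix (Fin p) (Fin q) ℝ) :
    ddet 1 (fun i j => Sum.elim (H i) (Ξ i) j) = (H * Hᵀ + Ξ * Ξᵀ).det := by
  rw [ddet]; congr 1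
  ext i j
  rw [Matrix.mul_one, Matrix.mul_apply]
  simp [Matrix.mul_apply, Fintype.sum_sum_type]

lemma L_eq {p r q : ℕ} (hr : 0 < r) (hq : 0 < q) (H : Matrix (Fin p) (Fin r) ℝ) (Ξ : Matrix (Fin p) (Fin q) ℝ)
    (h : 0 < (H * Hᵀ).det) (h2 : 0 < (H * Hᵀ + Ξ * Ξᵀ).det) :
    (if IsUnit ((r : ℝ)⁻¹ • (H * Hᵀ)) then
        Real.log ((1 + ((q : ℝ) / (r : ℝ)) •
          ((q : ℝ)⁻¹ • (Ξ * Ξᵀ) * ((r : ℝ)⁻¹ • (H * Hᵀ))⁻¹)).det)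
      else 0) = - Real.log ((H * Hᵀ).det / (H * Hᵀ + Ξ * Ξᵀ).det) := by
  have hr' : (r:ℝ) ≠ 0 := by positivity
  have hq' : (q:ℝ) ≠ 0 := by positivity
  have hu : IsUnit (H * Hᵀ).det := isUnit_iff_ne_zero.mpr h.ne'
  have hinv : ((r : ℝ)⁻¹ • (H * Hᵀ))⁻¹ = (r:ℝ) • (H * Hᵀ)⁻¹ := by
    apply inv_eq_right_inv
    rw [Matrix.smul_mul, Matrix.mul_smul, mul_nonsing_inv _ hu, smul_smul, inv_mul_cancel₀ hr', one_smul]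
  have hU : IsUnit ((r : ℝ)⁻¹ • (H * Hᵀ)) := by
    rw [isUnit_iff_isUnit_det, det_smul]
    exact isUnit_iff_ne_zero.mpr (mul_ne_zero (by positivity) h.ne')
  rw [if_pos hU, hinv]
  have e : (1 + ((q : ℝ) / (r : ℝ)) • ((q : ℝ)⁻¹ • (Ξ * Ξᵀ) * ((r:ℝ) • (H * Hᵀ)⁻¹))) = (H * Hᵀ + Ξ * Ξᵀ) * (H * Hᵀ)⁻¹ := by
    rw [Matrix.add_mul, mul_nonsing_inv _ hu, Matrix.smul_mul, Matrix.mul_smul, smul_smul, smul_smul]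
    have : (q:ℝ) / r * ((q:ℝ)⁻¹ * r) = 1 := by field_simp
    rw [← mul_assoc] at this
    simp only [mul_assoc] at this ⊢
    rw [this, one_smul]
  rw [e, det_mul, det_nonsing_inv, ← Real.log_inv, Ring.inverse_eq_inv', inv_div, div_eq_mul_inv]

lemma prod_chi (z : ℂ) (r N p : ℕ) :
    ∏ j ∈ Finset.range p, chiM z (r - j : ℕ) / chiM z (N - j : ℕ) = gprod z r p / gprod z N p := by
  rw [gprod, gprod, ← Finset.prod_div_distrib]
  refine Finset.prod_congr rfl fun j _ => ?_
  rw [chiM, chiM, mul_div_mul_left]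
  simp [Complex.cpow_eq_zero_iff]

lemma limit_char (y₁ y₂ u : ℝ) (hy₁ : y₁ ∈ Set.Ioo (0 : ℝ) 1) (hy₂ : y₂ ∈ Set.Ioo (0 : ℝ) 1) (z : ℂ)
    (hz : z = -(u * Complex.I)) :
    Complex.exp (-(z^2 - z/2) * (Real.log (1-y₂):ℂ)) /
      Complex.exp (-(z^2 - z/2) * (Real.log (1 - y₁*y₂/(y₁+y₂)):ℂ)) =
    charFun (gaussianReal (wilksMean y₁ y₂) (Real.toNNReal (wilksVar y₁ y₂))) u := by
  rw [charFun_gaussianReal, Real.coe_toNNReal _ (wilksVar_nonneg hy₁ hy₂), wilksVar_eq hy₁ hy₂, wilksMean_eq hy₁ hy₂,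
    ← Complex.exp_sub]
  obtain ⟨a, b⟩ := hy₁
  obtain ⟨c, d⟩ := hy₂
  have h1 : 0 < 1 - y₂ := by linarith
  have h2 : 0 < y₁ + y₂ := by linarith
  have h3 : 0 < y₁ + y₂ - y₁ * y₂ := by nlinarith
  have e : 1 - y₁*y₂/(y₁+y₂) = (y₁ + y₂ - y₁ * y₂) / (y₁ + y₂) := by field_simp
  rw [e, Real.log_div h3.ne' h2.ne', Real.log_div h3.ne' (by positivity), Real.log_mul h1.ne' h2.ne', hz]
  congr 1
  push_cast
  ring_nf
  simp only [Complex.I_sq]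
  ring

lemma char_one {Ω : Type} [MeasurableSpace Ω] (P : Measure Ω) [IsProbabilityMeasure P] {p q r : ℕ}
    (Ξ : Ω → Matrix (Fin p) (Fin q) ℝ) (H : Ω → Matrix (Fin p) (Fin r) ℝ)
    (hmeasΞ : ∀ i j, Measurable (fun ω => Ξ ω i j))
    (hmeasH : ∀ i j, Measurable (fun ω => H ω i j))
    (hindep : iIndepFun
      (Sum.elim (fun (ij : Fin p × Fin q) ω => Ξ ω ij.1 ij.2)
        (fun (ij : Fin p × Fin r) ω => H ω ij.1 ij.2)) P)
    (hlaw : ∀ idx, Measure.map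
      (Sum.elim (fun (ij : Fin p × Fin q) ω => Ξ ω ij.1 ij.2)
        (fun (ij : Fin p × Fin r) ω => H ω ij.1 ij.2) idx) P = gaussianReal 0 1)
    (hpr : p ≤ r) (z : ℂ) (hz : z.re = 0) :
    (∀ᵐ ω ∂P, 0 < (H ω * (H ω)ᵀ).det ∧ 0 < (H ω * (H ω)ᵀ + Ξ ω * (Ξ ω)ᵀ).det) ∧
    ∫ ω, Complex.exp (z * Real.log ((H ω * (H ω)ᵀ).det / (H ω * (H ω)ᵀ + Ξ ω * (Ξ ω)ᵀ).det)) ∂P =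
      gprod z r p / gprod z (r + q) p := by
  let e : Fin p × (Fin r ⊕ Fin q) → (Fin p × Fin q) ⊕ (Fin p × Fin r) :=
    fun x => Sum.elim (fun j => Sum.inr (x.1, j)) (fun j => Sum.inl (x.1, j)) x.2
  have he : Function.Injective e := by
    rintro ⟨i, j | j⟩ ⟨i', j' | j'⟩ h <;> simp [e] at h ⊢ <;> exact h
  have hi := hindep.precomp he
  have hm : ∀ idx, Measurable (Sum.elim (fun (ij : Fin p × Fin q) ω => Ξ ω ij.1 ij.2)
        (fun (ij : Fin p × Fin r) ω => H ω ij.1 ij.2) idx) := by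
    rintro (⟨i, j⟩ | ⟨i, j⟩)
    · exact hmeasΞ i j
    · exact hmeasH i j
  have hl := law_curry P _ (fun x => hm (e x)) hi (fun x => hlaw (e x))
  have hG : (fun ω (i : Fin p) (j : Fin r ⊕ Fin q) => (Sum.elim (fun (ij : Fin p × Fin q) ω => Ξ ω ij.1 ij.2)
        (fun (ij : Fin p × Fin r) ω => H ω ij.1 ij.2)) (e (i, j)) ω) = fun ω i j => Sum.elim (H ω i) (Ξ ω i) j := by
    funext ω i j
    rcases j with j | j <;> rfl
  have hGm : Measurable (fun ω (i : Fin p) (j : Fin r ⊕ Fin q) => Sum.elim (H ω i) (Ξ ω i) j) := by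
    rw [← hG]
    exact measurable_pi_lambda _ fun i => measurable_pi_lambda _ fun j => hm _
  have hl' : P.map (fun ω (i : Fin p) (j : Fin r ⊕ Fin q) => Sum.elim (H ω i) (Ξ ω i) j) = Measure.pi (fun _ : Fin p => gpi (Fin r ⊕ Fin q)) := by
    rw [← hl, ← hG]
  obtain ⟨r1, r2⟩ := rows z hz (maskE r q) (maskE_t r q) (maskE_i r q) r (maskE_tr r q) (by simp) p hpr
  rw [← hl'] at r1 r2
  have r1' := ae_of_ae_map hGm.aemeasurable r1
  have m3 : ∀ E₁ E₂ : Matrix (Fin r ⊕ Fin q) (Fin r ⊕ Fin q) ℝ, Measurable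
      (fun G : Fin p → Fin r ⊕ Fin q → ℝ => Complex.exp (z * Real.log (ddet E₁ G / ddet E₂ G))) := fun E₁ E₂ => by
    have m1 := ddet_meas (k := p) E₁
    have m2 := ddet_meas (k := p) E₂
    fun_prop
  rw [integral_map hGm.aemeasurable (m3 _ _).aestronglyMeasurable, prod_chi] at r2
  simp only [ddet_mask, ddet_one, Fintype.card_sum, Fintype.card_fin] at r1' r2
  exact ⟨r1', r2⟩

/-- CLT for `L_n = log det(I + (q₁/(n−q)) S₁S₂⁻¹)` built from two independent
standard Gaussian random matrices (`S₁ = (1/q₁)ΞΞᵀ`, `S₂ = (1/(n−q))HHᵀ`): under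
`p/q₁ → y₁ ∈ (0,1)`, `p/(n−q) → y₂ ∈ (0,1)` (with `p, q₁, n−q → ∞`),
`L_n − p·F_n` converges in distribution to `N(m, v)`.  Here `r t` plays the role of `n − q`. -/
theorem stmt8
    (p q₁ r : ℕ → ℕ)
    (Ω : ℕ → Type) [∀ t, MeasurableSpace (Ω t)] (P : ∀ t, Measure (Ω t))
    (hP : ∀ t, IsProbabilityMeasure (P t))
    (Ξ : ∀ t, Ω t → Matrix (Fin (p t)) (Fin (q₁ t)) ℝ)
    (H : ∀ t, Ω t → Matrix (Fin (p t)) (Fin (r t)) ℝ)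
    (hmeasΞ : ∀ t i j, Measurable (fun ω => Ξ t ω i j))
    (hmeasH : ∀ t i j, Measurable (fun ω => H t ω i j))
    -- all entries of `Ξ` and `H` are mutually independent ...
    (hindep : ∀ t, iIndepFun
      (Sum.elim (fun (ij : Fin (p t) × Fin (q₁ t)) ω => Ξ t ω ij.1 ij.2)
        (fun (ij : Fin (p t) × Fin (r t)) ω => H t ω ij.1 ij.2)) (P t))
    -- ... and each is standard normal `N(0,1)`
    (hlaw : ∀ t idx, Measure.map
      (Sum.elim (fun (ij : Fin (p t) × Fin (q₁ t)) ω => Ξ t ω ij.1 ij.2)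
        (fun (ij : Fin (p t) × Fin (r t)) ω => H t ω ij.1 ij.2) idx) (P t) = gaussianReal 0 1)
    (y₁ y₂ : ℝ) (hy₁ : y₁ ∈ Set.Ioo (0 : ℝ) 1) (hy₂ : y₂ ∈ Set.Ioo (0 : ℝ) 1)
    (hp : Tendsto p atTop atTop) (hq₁ : Tendsto q₁ atTop atTop) (hr : Tendsto r atTop atTop)
    (hyn1 : Tendsto (fun t => (p t : ℝ) / (q₁ t : ℝ)) atTop (nhds y₁))
    (hyn2 : Tendsto (fun t => (p t : ℝ) / (r t : ℝ)) atTop (nhds y₂))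
    (L : ∀ t, Ω t → ℝ)
    (hL : ∀ t ω, L t ω =
      if IsUnit ((r t : ℝ)⁻¹ • (H t ω * (H t ω)ᵀ)) then
        Real.log ((1 + ((q₁ t : ℝ) / (r t : ℝ)) •
          ((q₁ t : ℝ)⁻¹ • (Ξ t ω * (Ξ t ω)ᵀ) * ((r t : ℝ)⁻¹ • (H t ω * (H t ω)ᵀ))⁻¹)).det)
      else 0) :
    ∀ g : BoundedContinuousFunction ℝ ℝ,
      Tendsto
        (fun t => ∫ ω, g (L t ω - (p t : ℝ) * wilksF ((p t : ℝ) / (q₁ t)) ((p t : ℝ) / (r t)))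
          ∂(P t))
        atTop
        (nhds (∫ x, g x ∂(gaussianReal (wilksMean y₁ y₂) (Real.toNNReal (wilksVar y₁ y₂))))) := by
  have hpq : ∀ᶠ t in atTop, p t < q₁ t := (seq_facts hy₁ hq₁ hyn1).1
  have hpr : ∀ᶠ t in atTop, p t < r t := (seq_facts hy₂ hr hyn2).1
  have hp0 : ∀ᶠ t in atTop, 0 < p t := hp.eventually_gt_atTop 0
  have hdm : ∀ {t : ℕ} {n : ℕ} (A : Ω t → Matrix (Fin n) (Fin n) ℝ), (∀ i j, Measurable (fun ω => A ω i j)) →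
      Measurable (fun ω => (A ω).det) := by
    intro t n A hA
    simp only [det_apply]
    refine Finset.measurable_sum _ fun σ _ => Measurable.const_smul ?_ _
    exact Finset.measurable_prod _ fun i _ => hA _ _
  set c : ℕ → ℝ := fun t => (p t : ℝ) * wilksF ((p t : ℝ) / (q₁ t)) ((p t : ℝ) / (r t)) with hc
  set K : ∀ t, Ω t → ℝ := fun t ω => -Real.log ((H t ω * (H t ω)ᵀ).det / (H t ω * (H t ω)ᵀ + Ξ t ω * (Ξ t ω)ᵀ).det) - c t with hK
  have hKm : ∀ t, Measurable (K t) := by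
    intro t
    have a1 : Measurable (fun ω => (H t ω * (H t ω)ᵀ).det) := by
      refine hdm _ fun i j => ?_
      simp only [Matrix.mul_apply, transpose_apply]
      exact Finset.measurable_sum _ fun k _ => (hmeasH t i k).mul (hmeasH t j k)
    have a2 : Measurable (fun ω => (H t ω * (H t ω)ᵀ + Ξ t ω * (Ξ t ω)ᵀ).det) := by
      refine hdm _ fun i j => ?_
      simp only [Matrix.add_apply, Matrix.mul_apply, transpose_apply]
      exact (Finset.measurable_sum _ fun k _ => (hmeasH t i k).mul (hmeasH t j k)).add
        (Finset.measurable_sum _ fun k _ => (hmeasΞ t i k).mul (hmeasΞ t j k))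
    exact ((Real.measurable_log.comp (a1.div a2)).neg).sub measurable_const
  let μ : ℕ → ProbabilityMeasure ℝ := fun t =>
    ⟨(P t).map (K t), by have := hP t; exact Measure.isProbabilityMeasure_map (hKm t).aemeasurable⟩
  let μ₀ : ProbabilityMeasure ℝ := ⟨gaussianReal (wilksMean y₁ y₂) (Real.toNNReal (wilksVar y₁ y₂)), inferInstance⟩
  have hconv : Tendsto μ atTop (nhds μ₀) := by
    rw [ProbabilityMeasure.tendsto_iff_tendsto_charFun]
    intro u
    set z : ℂ := -(u * Complex.I) with hz
    have hz0 : z.re = 0 := by simp [hz]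
    have hN : Tendsto (fun t => r t + q₁ t) atTop atTop := tendsto_atTop_mono (fun t => Nat.le_add_right _ _) hr
    have hyN : Tendsto (fun t => (p t : ℝ) / ((r t + q₁ t : ℕ) : ℝ)) atTop (nhds (y₁*y₂/(y₁+y₂))) := by
      have h := (hyn1.mul hyn2).div (hyn1.add hyn2) (by linarith [hy₁.1, hy₂.1])
      refine h.congr' ?_
      filter_upwards [hpq, hpr, hp0] with t a b d
      have h1 : (0:ℝ) < p t := by exact_mod_cast d
      have h2 : (0:ℝ) < q₁ t := by exact_mod_cast d.trans a
      have h3 : (0:ℝ) < r t := by exact_mod_cast d.trans b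
      push_cast
      simp only [Pi.mul_apply, Pi.add_apply, Pi.div_apply]
      field_simp
    have hyN' : y₁*y₂/(y₁+y₂) ∈ Set.Ioo (0:ℝ) 1 := by
      obtain ⟨a, b⟩ := hy₁
      obtain ⟨a', b'⟩ := hy₂
      refine ⟨by positivity, ?_⟩
      rw [div_lt_one (by positivity)]
      nlinarith
    have t1 := gprod_tendsto z hy₂ hr hyn2
    have t2 := gprod_tendsto z hyN' hN hyN
    have t3 := t1.div t2 (Complex.exp_ne_zero _)
    rw [limit_char y₁ y₂ u hy₁ hy₂ z hz] at t3
    refine t3.congr' ?_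
    filter_upwards [hpq, hpr, hp0] with t a b d
    have := hP t
    obtain ⟨-, h2⟩ := char_one (P t) (Ξ t) (H t) (hmeasΞ t) (hmeasH t) (hindep t) (hlaw t) b.le z hz0
    have hF := wilksF_eq (p := (p t : ℝ)) (q := q₁ t) (r := r t) (by exact_mod_cast d) (by exact_mod_cast a) (by exact_mod_cast b)
    have hcc : c t = gcent ((r t + q₁ t : ℕ) : ℝ) (p t) - gcent (r t) (p t) := by
      rw [hc]; simp only; rw [hF, gcent, gcent]; push_cast; ring
    change _ = charFun ((P t).map (K t)) u
    rw [charFun_apply_real, integral_map (hKm t).aemeasurable (Measurable.aestronglyMeasurable (by fun_prop))]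
    have e1 : ∀ ω, Complex.exp ((u:ℂ) * (K t ω : ℂ) * Complex.I) =
        Complex.exp (z * Real.log ((H t ω * (H t ω)ᵀ).det / (H t ω * (H t ω)ᵀ + Ξ t ω * (Ξ t ω)ᵀ).det)) * Complex.exp (z * (c t : ℂ)) := by
      intro ω
      rw [← Complex.exp_add, hK, hz]
      congr 1; push_cast; ring
    simp only [e1]
    rw [integral_mul_const, h2, hcc, Pi.div_apply]
    rw [mul_div_mul_comm, ← Complex.exp_sub]
    congr 2
    push_cast; ring
  intro g
  have h := (ProbabilityMeasure.tendsto_iff_forall_integral_tendsto.mp hconv) g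
  refine h.congr' ?_
  filter_upwards [hpq, hpr, hp0] with t a b d
  have := hP t
  obtain ⟨h1, -⟩ := char_one (P t) (Ξ t) (H t) (hmeasΞ t) (hmeasH t) (hindep t) (hlaw t) b.le 0 rfl
  change ∫ x, g x ∂((P t).map (K t)) = _
  rw [integral_map (hKm t).aemeasurable g.continuous.measurable.aestronglyMeasurable]
  apply integral_congr_ae
  filter_upwards [h1] with ω hω
  rw [hL t ω, L_eq (by omega) (by omega) _ _ hω.1 hω.2]
end

section
/- Consider the multivariate linear regression model x_i = B z_i + ε_i, i = 1,…,n, with x_i ∈ ℝ^p, B = (B₁, B₂) a p×q coefficient matrix with blocks of q₁ and q₂ = q−q₁ columns, nonrandom regressors z_iᵀ = (z_{i,1}ᵀ, z_{i,2}ᵀ) ∈ ℝ^q with Z = (z₁,…,z_n) of full rank q, and ε₁,…,ε_n i.i.d. mean-zero random vectors in ℝ^p with covariance matrix Σ and finite fourth moments. Assume B₁ = B₁*, and let B̂₁ denote the first q₁ columns of the least-squares estimator B̂ = (Σᵢ x_i z_iᵀ)(Σᵢ z_i z_iᵀ)^{−1}. Define A_{11:2} = A₁₁ − A₁₂A₂₂^{−1}A₂₁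 from the block decomposition of Σᵢ z_i z_iᵀ, M_{n,1} = tr((B̂₁−B₁*)(B̂₁−B₁*)ᵀ), M_{n,2} = tr((B̂₁−B₁*)A_{11:2}(B̂₁−B₁*)ᵀ), β_x = E(ε₁ᵀε₁)² − (tr Σ)² − 2·tr(Σ²), β_{z1} = Σᵢ [ (z_{i,1}ᵀ − z_{i,2}ᵀA₂₂^{−1}A₂₁) A_{11:2}^{−2} (z_{i,1} − A₁₂A₂₂^{−1}z_{i,2}) ]², and β_{z2} = Σᵢ [ (z_{i,1}ᵀ − z_{i,2}ᵀA₂₂^{−1}A₂₁) A_{11:2}^{−1} (z_{i,1} − A₁₂A₂₂^{−1}z_{i,2}) ]². Then: E M_{n,1} = tr(Σ)·tr(A_{11:2}^{−1}), E M_{n,2} = q₁·tr(Σ), Var(M_{n,1}) = 2·tr(Σ²)·tr(A_{11:2}^{−2}) + β_x·β_{z1}, and Var(M_{n,2}) = 2·q₁·tr(Σ²) + β_x·β_{z2}. -/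
open Real MeasureTheory ProbabilityTheory Matrix

lemma abs4 (a b c d : ℝ) : ‖a*b*(c*d)‖ ≤ a^4+b^4+c^4+d^4 := by
  rw [Real.norm_eq_abs, abs_le]
  constructor <;> nlinarith [sq_nonneg (a*b-c*d), sq_nonneg (a*b+c*d), sq_nonneg (a^2-b^2), sq_nonneg (c^2-d^2), sq_nonneg (a^2), sq_nonneg (b^2), sq_nonneg (c^2), sq_nonneg (d^2), sq_nonneg (a*b), sq_nonneg (c*d)]

section
set_option linter.unusedSectionVars false
variable {n p : ℕ} {Ω : Type} [MeasurableSpace Ω] {P : Measure Ω} [IsProbabilityMeasure P]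
  {Sig : Matrix (Fin p) (Fin p) ℝ} {ε : Fin n → Ω → (Fin p → ℝ)} {με : Measure (Fin p → ℝ)}

lemma int4 (hmeas : ∀ i, Measurable (ε i)) (hlaw : ∀ i, Measure.map (ε i) P = με)
    (hmom4 : Integrable (fun u : Fin p → ℝ => (∑ j, u j ^ 2) ^ 2) με) (i : Fin n) (a : Fin p) :
    Integrable (fun ω => ε i ω a ^ 4) P := by
  have h : Integrable (fun u : Fin p → ℝ => u a ^ 4) με := by
    refine hmom4.mono' ((measurable_pi_apply a).pow_const 4).aestronglyMeasurable (Filter.Eventually.of_forall fun u => ?_)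
    have h1 : u a ^ 2 ≤ ∑ j, u j ^ 2 :=
      Finset.single_le_sum (f := fun j => u j ^ 2) (fun j _ => sq_nonneg _) (Finset.mem_univ a)
    rw [Real.norm_eq_abs, abs_of_nonneg (by positivity)]
    nlinarith [sq_nonneg (u a)]
  rw [← hlaw i] at h
  exact h.comp_measurable (hmeas i)

lemma int1111 (hmeas : ∀ i, Measurable (ε i)) (hlaw : ∀ i, Measure.map (ε i) P = με)
    (hmom4 : Integrable (fun u : Fin p → ℝ => (∑ j, u j ^ 2) ^ 2) με)
    (i k j l : Fin n) (a b c d : Fin p) :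
    Integrable (fun ω => ε i ω a * ε k ω b * (ε j ω c * ε l ω d)) P := by
  have H := int4 hmeas hlaw hmom4
  refine ((((H i a).add (H k b)).add (H j c)).add (H l d)).mono' ?_
    (Filter.Eventually.of_forall fun u => abs4 _ _ _ _)
  have h := fun (i : Fin n) (a : Fin p) => (measurable_pi_apply a).comp (hmeas i)
  exact (((h i a).mul (h k b)).mul ((h j c).mul (h l d))).aestronglyMeasurable

lemma int11 (hmeas : ∀ i, Measurable (ε i)) (hlaw : ∀ i, Measure.map (ε i) P = με)
    (hmom4 : Integrable (fun u : Fin p → ℝ => (∑ j, u j ^ 2) ^ 2) με)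
    (i k : Fin n) (a b : Fin p) :
    Integrable (fun ω => ε i ω a * ε k ω b) P := by
  have H := int4 hmeas hlaw hmom4
  have h := fun (i : Fin n) (a : Fin p) => (measurable_pi_apply a).comp (hmeas i)
  refine (((H i a).add (H k b)).add (integrable_const (2:ℝ))).mono' 
    ((h i a).mul (h k b)).aestronglyMeasurable
    (Filter.Eventually.of_forall fun u => ?_)
  have := abs4 (ε i u a) (ε k u b) 1 1
  simp at this ⊢
  linarith

lemma E1 (hmeas : ∀ i, Measurable (ε i)) (hlaw : ∀ i, Measure.map (ε i) P = με)
    (hmean : ∀ j, ∫ u, u j ∂με = 0) (i : Fin n) (a : Fin p) : ∫ ω, ε i ω a ∂P = 0 := by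
  rw [← hmean a, ← hlaw i, integral_map (hmeas i).aemeasurable
    (measurable_pi_apply a).aestronglyMeasurable]

lemma E2 (hmeas : ∀ i, Measurable (ε i)) (hlaw : ∀ i, Measure.map (ε i) P = με)
    (hcov : ∀ a b, ∫ u, u a * u b ∂με = Sig a b) (i : Fin n) (a b : Fin p) :
    ∫ ω, ε i ω a * ε i ω b ∂P = Sig a b := by
  rw [← hcov a b, ← hlaw i, integral_map (hmeas i).aemeasurable]
  exact ((measurable_pi_apply a).mul (measurable_pi_apply b)).aestronglyMeasurable

lemma E0 (hmeas : ∀ i, Measurable (ε i)) (hlaw : ∀ i, Measure.map (ε i) P = με)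
    (hindep : iIndepFun ε P)
    (hmean : ∀ j, ∫ u, u j ∂με = 0) (i k j l : Fin n) (hk : i ≠ k) (hj : i ≠ j) (hl : i ≠ l)
    (a b c d : Fin p) : ∫ ω, ε i ω a * (ε k ω b * (ε j ω c * ε l ω d)) ∂P = 0 := by
  have h := hindep.indepFun_finset {i} {k, j, l} (by simp; tauto) hmeas
  have h2 := h.comp (φ := fun f : ({i} : Finset (Fin n)) → Fin p → ℝ => f ⟨i, by simp⟩ a)
    (ψ := fun f : ({k, j, l} : Finset (Fin n)) → Fin p → ℝ =>
      f ⟨k, by simp⟩ b * (f ⟨j, by simp⟩ c * f ⟨l, by simp⟩ d)) (by fun_prop) (by fun_prop)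
  have h' := fun (i : Fin n) (a : Fin p) => (measurable_pi_apply a).comp (hmeas i)
  have h3 := h2.integral_mul_eq_mul_integral (h' i a).aestronglyMeasurable
    ((h' k b).mul ((h' j c).mul (h' l d))).aestronglyMeasurable
  have h4 := E1 hmeas hlaw hmean i a
  refine h3.trans ?_
  simp only [Function.comp_def]
  rw [h4, zero_mul]

lemma E11 (hmeas : ∀ i, Measurable (ε i)) (hlaw : ∀ i, Measure.map (ε i) P = με)
    (hindep : iIndepFun ε P)
    (hmean : ∀ j, ∫ u, u j ∂με = 0) (i k : Fin n) (hk : i ≠ k)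
    (a b : Fin p) : ∫ ω, ε i ω a * ε k ω b ∂P = 0 := by
  have h2 := (hindep.indepFun hk).comp (φ := fun f : Fin p → ℝ => f a)
    (ψ := fun f : Fin p → ℝ => f b) (measurable_pi_apply (X := fun _ => ℝ) a)
    (measurable_pi_apply (X := fun _ => ℝ) b)
  have h' := fun (i : Fin n) (a : Fin p) => (measurable_pi_apply a).comp (hmeas i)
  have h3 := h2.integral_mul_eq_mul_integral (h' i a).aestronglyMeasurable
    (h' k b).aestronglyMeasurable
  refine h3.trans ?_
  simp only [Function.comp_def]
  rw [E1 hmeas hlaw hmean i a, zero_mul]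

lemma E22 (hmeas : ∀ i, Measurable (ε i)) (hlaw : ∀ i, Measure.map (ε i) P = με)
    (hindep : iIndepFun ε P)
    (hcov : ∀ a b, ∫ u, u a * u b ∂με = Sig a b) (i k : Fin n) (hk : i ≠ k)
    (a b c d : Fin p) :
    ∫ ω, (ε i ω a * ε i ω b) * (ε k ω c * ε k ω d) ∂P = Sig a b * Sig c d := by
  have h2 := (hindep.indepFun hk).comp (φ := fun f => f a * f b) (ψ := fun f => f c * f d)
    (by fun_prop) (by fun_prop)
  have h' := fun (i : Fin n) (a : Fin p) => (measurable_pi_apply a).comp (hmeas i)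
  have h3 := h2.integral_mul_eq_mul_integral ((h' i a).mul (h' i b)).aestronglyMeasurable
    ((h' k c).mul (h' k d)).aestronglyMeasurable
  refine h3.trans ?_
  simp only [Function.comp_def]
  rw [E2 hmeas hlaw hcov, E2 hmeas hlaw hcov]

lemma EY (hmeas : ∀ i, Measurable (ε i)) (hlaw : ∀ i, Measure.map (ε i) P = με)
    (hindep : iIndepFun ε P) (hmean : ∀ j, ∫ u, u j ∂με = 0)
    (hcov : ∀ a b, ∫ u, u a * u b ∂με = Sig a b)
    (hmom4 : Integrable (fun u : Fin p → ℝ => (∑ j, u j ^ 2) ^ 2) με) (i k : Fin n) :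
    ∫ ω, ε i ω ⬝ᵥ ε k ω ∂P = if i = k then Sig.trace else 0 := by
  simp only [dotProduct]
  rw [integral_finsetSum _ fun a _ => int11 hmeas hlaw hmom4 i k a a]
  split_ifs with h
  · subst h
    simp [E2 hmeas hlaw hcov, Matrix.trace]
  · simp [E11 hmeas hlaw hindep hmean i k h]

lemma intYY (hmeas : ∀ i, Measurable (ε i)) (hlaw : ∀ i, Measure.map (ε i) P = με)
    (hmom4 : Integrable (fun u : Fin p → ℝ => (∑ j, u j ^ 2) ^ 2) με) (i k j l : Fin n) :
    Integrable (fun ω => (ε i ω ⬝ᵥ ε k ω) * (ε j ω ⬝ᵥ ε l ω)) P := by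
  simp only [dotProduct, Finset.sum_mul_sum]
  exact integrable_finsetSum _ fun a _ => integrable_finsetSum _ fun b _ =>
    int1111 hmeas hlaw hmom4 i k j l a a b b

lemma EYY (hmeas : ∀ i, Measurable (ε i)) (hlaw : ∀ i, Measure.map (ε i) P = με)
    (hindep : iIndepFun ε P) (hmean : ∀ j, ∫ u, u j ∂με = 0)
    (hcov : ∀ a b, ∫ u, u a * u b ∂με = Sig a b)
    (hmom4 : Integrable (fun u : Fin p → ℝ => (∑ j, u j ^ 2) ^ 2) με) (i k j l : Fin n) :
    ∫ ω, (ε i ω ⬝ᵥ ε k ω) * (ε j ω ⬝ᵥ ε l ω) ∂P =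
      (if i = k then if j = l then Sig.trace ^ 2 else 0 else 0) +
      (if i = j then if k = l then (Sig ^ 2).trace else 0 else 0) +
      (if i = l then if k = j then (Sig ^ 2).trace else 0 else 0) +
      (if i = k then if i = j then if i = l then
        ((∫ u, (∑ j, u j ^ 2) ^ 2 ∂με) - Sig.trace ^ 2 - 2 * (Sig ^ 2).trace) else 0 else 0 else 0)
      := by
  have hsym : ∀ a b, Sig a b = Sig b a := fun a b => by
    rw [← hcov, ← hcov]; simp only [mul_comm]
  have htr2 : (Sig ^ 2).trace = ∑ a, ∑ b, Sig a b * Sig a b := by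
    simp only [Matrix.trace, sq, Matrix.diag, Matrix.mul_apply]
    exact Finset.sum_congr rfl fun a _ => Finset.sum_congr rfl fun b _ => by rw [hsym b a]
  have htr : Sig.trace ^ 2 = ∑ a, ∑ b, Sig a a * Sig b b := by
    simp only [Matrix.trace, sq, Matrix.diag, Finset.sum_mul_sum]
  have hexp : ∫ ω, (ε i ω ⬝ᵥ ε k ω) * (ε j ω ⬝ᵥ ε l ω) ∂P =
      ∑ a, ∑ b, ∫ ω, ε i ω a * ε k ω a * (ε j ω b * ε l ω b) ∂P := by
    simp only [dotProduct, Finset.sum_mul_sum]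
    rw [integral_finsetSum _ fun a _ => integrable_finsetSum _ fun b _ =>
      int1111 hmeas hlaw hmom4 i k j l a a b b]
    exact Finset.sum_congr rfl fun a _ => integral_finsetSum _ fun b _ =>
      int1111 hmeas hlaw hmom4 i k j l a a b b
  have z1 : i ≠ k → i ≠ j → i ≠ l → ∀ a b,
      ∫ ω, ε i ω a * ε k ω a * (ε j ω b * ε l ω b) ∂P = 0 := fun h1 h2 h3 a b => by
    rw [← E0 hmeas hlaw hindep hmean i k j l h1 h2 h3 a a b b]
    congr 1; ext ω; ring
  have z2 : k ≠ i → k ≠ j → k ≠ l → ∀ a b,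
      ∫ ω, ε i ω a * ε k ω a * (ε j ω b * ε l ω b) ∂P = 0 := fun h1 h2 h3 a b => by
    rw [← E0 hmeas hlaw hindep hmean k i j l h1 h2 h3 a a b b]
    congr 1; ext ω; ring
  have z3 : j ≠ i → j ≠ k → j ≠ l → ∀ a b,
      ∫ ω, ε i ω a * ε k ω a * (ε j ω b * ε l ω b) ∂P = 0 := fun h1 h2 h3 a b => by
    rw [← E0 hmeas hlaw hindep hmean j i k l h1 h2 h3 b a a b]
    congr 1; ext ω; ring
  have z4 : l ≠ i → l ≠ k → l ≠ j → ∀ a b,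
      ∫ ω, ε i ω a * ε k ω a * (ε j ω b * ε l ω b) ∂P = 0 := fun h1 h2 h3 a b => by
    rw [← E0 hmeas hlaw hindep hmean l i k j h1 h2 h3 b a a b]
    congr 1; ext ω; ring
  by_cases hik : i = k
  · subst hik
    by_cases hjl : j = l
    · subst hjl
      by_cases hij : i = j
      · subst hij
        have : ∫ u, (∑ j, u j ^ 2) ^ 2 ∂με = ∫ ω, (ε i ω ⬝ᵥ ε i ω) * (ε i ω ⬝ᵥ ε i ω) ∂P := by
          rw [← hlaw i, integral_map (hmeas i).aemeasurable]
          · simp only [dotProduct, sq]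
          · exact (Finset.measurable_sum _ fun a _ =>
              (measurable_pi_apply a).pow_const 2).pow_const 2 |>.aestronglyMeasurable
        simp only [if_true, this]; ring
      · rw [hexp]
        simp only [E22 hmeas hlaw hindep hcov i j hij, if_true, if_neg hij, htr, add_zero]
    · rw [hexp]
      by_cases hij : i = j
      · subst hij
        simp [z4 (Ne.symm hjl) (Ne.symm hjl) (Ne.symm hjl), hjl]
      · simp [z3 (Ne.symm hij) (Ne.symm hij) hjl, hjl, hij]
  · rw [hexp]
    by_cases hij : i = j
    · subst hij
      by_cases hkl : k = l
      · subst hkl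
        have : ∀ a b, ∫ ω, ε i ω a * ε k ω a * (ε i ω b * ε k ω b) ∂P = Sig a b * Sig a b := by
          intro a b
          rw [← E22 hmeas hlaw hindep hcov i k hik a b a b]
          congr 1; ext ω; ring
        simp [this, hik, htr2]
      · simp [z2 (Ne.symm hik) (Ne.symm hik) hkl, hik, hkl, Ne.symm hik]
    · by_cases hil : i = l
      · subst hil
        by_cases hkj : k = j
        · subst hkj
          have : ∀ a b, ∫ ω, ε i ω a * ε k ω a * (ε k ω b * ε i ω b) ∂P = Sig a b * Sig a b := by
            intro a b
            rw [← E22 hmeas hlaw hindep hcov i k hik a b a b]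
            congr 1; ext ω; ring
          simp [this, hik, htr2]
        · simp [z2 (Ne.symm hik) hkj (Ne.symm hik), hik, hij, hkj]
      · simp [z1 hik hij hil, hik, hij, hil]

lemma quad (hmeas : ∀ i, Measurable (ε i)) (hlaw : ∀ i, Measure.map (ε i) P = με)
    (hindep : iIndepFun ε P) (hmean : ∀ j, ∫ u, u j ∂με = 0)
    (hcov : ∀ a b, ∫ u, u a * u b ∂με = Sig a b)
    (hmom4 : Integrable (fun u : Fin p → ℝ => (∑ j, u j ^ 2) ^ 2) με)
    (C : Matrix (Fin n) (Fin n) ℝ) (hC : Cᵀ = C) (Q : Ω → ℝ)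
    (hQ : Q = fun ω => ((Matrix.of fun a i => ε i ω a) * C * (Matrix.of fun a i => ε i ω a)ᵀ).trace) :
    ∫ ω, Q ω ∂P = Sig.trace * C.trace ∧
    variance Q P = 2 * (Sig ^ 2).trace * (C * C).trace +
      ((∫ u, (∑ j, u j ^ 2) ^ 2 ∂με) - Sig.trace ^ 2 - 2 * (Sig ^ 2).trace) * ∑ i, C i i ^ 2 := by
  have hQ' : Q = fun ω => ∑ i, ∑ k, C i k * (ε i ω ⬝ᵥ ε k ω) := by
    rw [hQ]; ext ω
    simp only [Matrix.trace, Matrix.diag, Matrix.mul_apply, Matrix.of_apply, Matrix.transpose_apply,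
      dotProduct, Finset.mul_sum, Finset.sum_mul]
    rw [Finset.sum_comm, Finset.sum_congr rfl fun k _ => Finset.sum_comm, Finset.sum_comm]
    refine Finset.sum_congr rfl fun a _ => Finset.sum_congr rfl fun b _ =>
      Finset.sum_congr rfl fun c _ => by ring
  have hQ2 : (fun ω => Q ω ^ 2) = fun ω => ∑ i, ∑ k, ∑ j, ∑ l, C i k * C j l *
      ((ε i ω ⬝ᵥ ε k ω) * (ε j ω ⬝ᵥ ε l ω)) := by
    rw [hQ']; ext ω
    simp only [sq, Finset.sum_mul, Finset.mul_sum]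
    refine Finset.sum_congr rfl fun a _ => Finset.sum_congr rfl fun b _ =>
      Finset.sum_congr rfl fun c _ => Finset.sum_congr rfl fun d _ => by ring
  have hY : ∀ i k, Integrable (fun ω => C i k * (ε i ω ⬝ᵥ ε k ω)) P := fun i k =>
    (integrable_finsetSum _ fun a _ => int11 hmeas hlaw hmom4 i k a a).const_mul _
  have hYY : ∀ i k j l, Integrable (fun ω => C i k * C j l *
      ((ε i ω ⬝ᵥ ε k ω) * (ε j ω ⬝ᵥ ε l ω))) P := fun i k j l =>
    (intYY hmeas hlaw hmom4 i k j l).const_mul _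
  have hQi : Integrable Q P := by
    rw [hQ']
    exact integrable_finsetSum _ fun i _ => integrable_finsetSum _ fun k _ => hY i k
  have hQ2i : Integrable (fun ω => Q ω ^ 2) P := by
    rw [hQ2]
    exact integrable_finsetSum _ fun i _ => integrable_finsetSum _ fun k _ =>
      integrable_finsetSum _ fun j _ => integrable_finsetSum _ fun l _ => hYY i k j l
  have hm : ∫ ω, Q ω ∂P = Sig.trace * C.trace := by
    rw [hQ', integral_finsetSum _ fun i _ => integrable_finsetSum _ fun k _ => hY i k]
    simp_rw [integral_finsetSum _ fun k _ => hY _ k, integral_const_mul,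
      EY hmeas hlaw hindep hmean hcov hmom4]
    simp [Matrix.trace, ← Finset.sum_mul, mul_comm]
  refine ⟨hm, ?_⟩
  have hs : ∀ i k, C i k = C k i := fun i k => by conv_lhs => rw [← hC, Matrix.transpose_apply]
  have hm2 : ∫ ω, Q ω ^ 2 ∂P = Sig.trace ^ 2 * C.trace ^ 2 + 2 * (Sig ^ 2).trace * (C * C).trace +
      ((∫ u, (∑ j, u j ^ 2) ^ 2 ∂με) - Sig.trace ^ 2 - 2 * (Sig ^ 2).trace) * ∑ i, C i i ^ 2 := by
    rw [hQ2, integral_finsetSum _ fun i _ => integrable_finsetSum _ fun k _ =>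
      integrable_finsetSum _ fun j _ => integrable_finsetSum _ fun l _ => hYY i k j l]
    simp_rw [integral_finsetSum _ fun k _ => 
      integrable_finsetSum _ fun j _ => integrable_finsetSum _ fun l _ => hYY _ k j l,
      integral_finsetSum _ fun j _ => integrable_finsetSum _ fun l _ => hYY _ _ j l,
      integral_finsetSum _ fun l _ => hYY _ _ _ l, integral_const_mul,
      EYY hmeas hlaw hindep hmean hcov hmom4]
    generalize ((∫ u, (∑ j, u j ^ 2) ^ 2 ∂με) - Sig.trace ^ 2 - 2 * (Sig ^ 2).trace) = β
    generalize Sig.trace ^ 2 = T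
    generalize (Sig ^ 2).trace = S
    simp only [mul_add, Finset.sum_add_distrib, mul_ite, mul_zero]
    have e1 : ∑ i, ∑ k, ∑ j, ∑ l, (if i = k then if j = l then C i k * C j l * T else 0 else 0)
        = T * C.trace ^ 2 := by
      simp [sq, Matrix.trace, Finset.mul_sum, mul_comm]
    have e2 : ∑ i, ∑ k, ∑ j, ∑ l, (if i = j then if k = l then C i k * C j l * S else 0 else 0)
        = S * (C * C).trace := by
      simp [Matrix.trace, Matrix.mul_apply, Finset.mul_sum]
      refine Finset.sum_congr rfl fun a _ => Finset.sum_congr rfl fun b _ => ?_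
      rw [hs b a]; ring
    have e3 : ∑ i, ∑ k, ∑ j, ∑ l, (if i = l then if k = j then C i k * C j l * S else 0 else 0)
        = S * (C * C).trace := by
      simp [Matrix.trace, Matrix.mul_apply, Finset.mul_sum]
      refine Finset.sum_congr rfl fun a _ => Finset.sum_congr rfl fun b _ => ?_
      ring
    have e4 : ∑ i, ∑ k, ∑ j, ∑ l, (if i = k then if i = j then if i = l then C i k * C j l * β
        else 0 else 0 else 0) = β * ∑ i, C i i ^ 2 := by
      simp [Finset.mul_sum]
      refine Finset.sum_congr rfl fun a _ => ?_
      ring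
    rw [e1, e2, e3, e4]; ring
  rw [variance_eq_sub ((memLp_two_iff_integrable_sq hQi.aestronglyMeasurable).2 hQ2i)]
  simp only [Pi.pow_apply]
  rw [hm, hm2]; ring
end

lemma linalg {n q₁ q₂ : ℕ} (Z : Matrix (Fin n) (Fin q₁ ⊕ Fin q₂) ℝ) (hrank : Zᵀ.rank = q₁ + q₂)
    (A : Matrix (Fin q₁ ⊕ Fin q₂) (Fin q₁ ⊕ Fin q₂) ℝ) (hA : A = Zᵀ * Z)
    (A112 : Matrix (Fin q₁) (Fin q₁) ℝ)
    (h112 : A112 = A.toBlocks₁₁ - A.toBlocks₁₂ * (A.toBlocks₂₂)⁻¹ * A.toBlocks₂₁)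
    (W : Matrix (Fin n) (Fin q₁) ℝ)
    (hW : W = Z.submatrix id Sum.inl -
      Z.submatrix id Sum.inr * (A.toBlocks₁₂ * (A.toBlocks₂₂)⁻¹)ᵀ) :
    A.det ≠ 0 ∧ A112.det ≠ 0 ∧ A112ᵀ = A112 ∧ Wᵀ * W = A112 ∧
      (Z * A⁻¹).submatrix id Sum.inl = W * A112⁻¹ := by
  have hAT : Aᵀ = A := by rw [hA]; simp
  have hru : A.rank = q₁ + q₂ := by
    rw [hA, ← hrank]
    simpa using Matrix.rank_self_mul_transpose Zᵀ
  have hAu : IsUnit A := by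
    rw [← linearIndependent_cols_iff_isUnit, linearIndependent_iff_card_eq_finrank_span,
      Set.finrank, ← rank_eq_finrank_span_cols, hru]
    simp
  have hAd : A.det ≠ 0 := ((Matrix.isUnit_iff_isUnit_det A).1 hAu).ne_zero
  have hpsd : A.PosSemidef := by
    rw [hA]; simpa using Matrix.posSemidef_conjTranspose_mul_self Z
  have hpd : A.PosDef := hpsd.posDef_iff_isUnit.2 hAu
  have h22 : A.toBlocks₂₂.PosDef := hpd.submatrix (e := Sum.inr) Sum.inr_injective
  have h22d : A.toBlocks₂₂.det ≠ 0 := h22.det_pos.ne'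
  have h22T : A.toBlocks₂₂ᵀ = A.toBlocks₂₂ := by
    conv_rhs => rw [← hAT]
    rfl
  have h12T : A.toBlocks₁₂ᵀ = A.toBlocks₂₁ := by
    conv_rhs => rw [← hAT]
    rfl
  have h11T : A.toBlocks₁₁ᵀ = A.toBlocks₁₁ := by
    conv_rhs => rw [← hAT]
    rfl
  have h21T : A.toBlocks₂₁ᵀ = A.toBlocks₁₂ := by
    rw [← h12T, transpose_transpose]
  have hS : A112ᵀ = A112 := by
    rw [h112]
    simp [transpose_sub, transpose_mul, h11T, h12T, h21T, transpose_nonsing_inv, h22T, Matrix.mul_assoc]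
  have hdet : A112.det ≠ 0 := by
    have : Invertible A.toBlocks₂₂ := Matrix.invertibleOfIsUnitDet _ h22d.isUnit
    have h := Matrix.det_fromBlocks₂₂ A.toBlocks₁₁ A.toBlocks₁₂ A.toBlocks₂₁ A.toBlocks₂₂
    rw [fromBlocks_toBlocks, invOf_eq_nonsing_inv, ← h112] at h
    intro h0
    rw [h0, mul_zero] at h
    exact hAd h
  let K : Matrix (Fin q₁ ⊕ Fin q₂) (Fin q₁) ℝ := fromRows 1 (-((A.toBlocks₂₂)⁻¹ * A.toBlocks₂₁))
  have hWK : W = Z * K := by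
    conv_rhs => rw [show Z = fromCols (Z.submatrix id Sum.inl) (Z.submatrix id Sum.inr) from by
      ext i (j | j) <;> rfl]
    simp only [K]
    rw [fromCols_mul_fromRows, hW, transpose_mul, h12T, transpose_nonsing_inv, h22T]
    simp [sub_eq_add_neg]
  have hAK : A * K = fromRows A112 0 := by
    conv_lhs => rw [← fromBlocks_toBlocks A]
    simp only [K]
    rw [fromBlocks_mul_fromRows]
    congr 1
    · rw [h112]; simp [sub_eq_add_neg, Matrix.mul_assoc]
    · simp [← Matrix.mul_assoc, Matrix.mul_nonsing_inv _ h22d.isUnit]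
  have hWW : Wᵀ * W = A112 := by
    rw [hWK, transpose_mul, Matrix.mul_assoc, ← Matrix.mul_assoc Zᵀ, ← hA, hAK]
    simp only [K, transpose_fromRows]
    rw [fromCols_mul_fromRows]; simp
  refine ⟨hAd, hdet, hS, hWW, ?_⟩
  let E : Matrix (Fin q₁ ⊕ Fin q₂) (Fin q₁) ℝ := fromRows 1 0
  have h1 : A * (K * A112⁻¹) = E := by
    rw [← Matrix.mul_assoc, hAK, fromRows_mul, Matrix.mul_nonsing_inv _ hdet.isUnit, Matrix.zero_mul]
  have h2 : K * A112⁻¹ = A⁻¹ * E := by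
    rw [← h1, ← Matrix.mul_assoc A⁻¹, Matrix.nonsing_inv_mul _ hAd.isUnit, Matrix.one_mul]
  have h3 : W * A112⁻¹ = (Z * A⁻¹) * E := by
    rw [hWK, Matrix.mul_assoc, h2, ← Matrix.mul_assoc]
  rw [h3]
  ext i j
  rw [Matrix.mul_apply]
  simp [E, Matrix.one_apply]

/-- mean and variance of the least-squares statistics
`M_{n,1} = tr((B̂₁−B₁*)(B̂₁−B₁*)ᵀ)` and `M_{n,2} = tr((B̂₁−B₁*)A_{11:2}(B̂₁−B₁*)ᵀ)` in the
multivariate regression model `xᵢ = B zᵢ + εᵢ` under the null `B₁ = B₁*`, for i.i.d.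
mean-zero noise with covariance `Σ` and finite fourth moments. -/
theorem stmt12
    (n p q₁ q₂ : ℕ)
    (Ω : Type) [MeasurableSpace Ω] (P : Measure Ω) (hP : IsProbabilityMeasure P)
    (B : Matrix (Fin p) (Fin q₁ ⊕ Fin q₂) ℝ)
    (B₁star : Matrix (Fin p) (Fin q₁) ℝ)
    (z : Fin n → (Fin q₁ ⊕ Fin q₂) → ℝ)
    (Sig : Matrix (Fin p) (Fin p) ℝ)
    (ε : Fin n → Ω → (Fin p → ℝ))
    (hmeas : ∀ i, Measurable (ε i))
    -- the noise vectors are i.i.d. with common law `με` ...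
    (με : Measure (Fin p → ℝ)) (hμprob : IsProbabilityMeasure με)
    (hindep : iIndepFun ε P)
    (hlaw : ∀ i, Measure.map (ε i) P = με)
    -- ... mean zero, covariance matrix `Σ`, and finite fourth moments
    (hmean : ∀ j, ∫ u, u j ∂με = 0)
    (hcov : ∀ a b, ∫ u, u a * u b ∂με = Sig a b)
    (hmom4 : Integrable (fun u : Fin p → ℝ => (∑ j, u j ^ 2) ^ 2) με)
    -- `Z = (z₁,…,z_n)` has full rank `q = q₁ + q₂`
    (hrank : (Matrix.of fun (a : Fin q₁ ⊕ Fin q₂) (i : Fin n) => z i a).rank = q₁ + q₂)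
    -- the null hypothesis `B₁ = B₁*`
    (hnull : ∀ a j, B a (Sum.inl j) = B₁star a j) :
    -- observations and least-squares estimator
    let x : Fin n → Ω → (Fin p → ℝ) := fun i ω => B.mulVec (z i) + ε i ω
    let A : Matrix (Fin q₁ ⊕ Fin q₂) (Fin q₁ ⊕ Fin q₂) ℝ := ∑ i, vecMulVec (z i) (z i)
    let Bhat : Ω → Matrix (Fin p) (Fin q₁ ⊕ Fin q₂) ℝ :=
      fun ω => (∑ i, vecMulVec (x i ω) (z i)) * A⁻¹
    let Bhat₁ : Ω → Matrix (Fin p) (Fin q₁) ℝ := fun ω => (Bhat ω).submatrix id Sum.inl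
    -- `A_{11:2} = A₁₁ − A₁₂A₂₂⁻¹A₂₁`
    let A112 : Matrix (Fin q₁) (Fin q₁) ℝ :=
      A.toBlocks₁₁ - A.toBlocks₁₂ * (A.toBlocks₂₂)⁻¹ * A.toBlocks₂₁
    let M₁ : Ω → ℝ := fun ω => ((Bhat₁ ω - B₁star) * (Bhat₁ ω - B₁star)ᵀ).trace
    let M₂ : Ω → ℝ := fun ω => ((Bhat₁ ω - B₁star) * A112 * (Bhat₁ ω - B₁star)ᵀ).trace
    -- `β_x = E(ε₁ᵀε₁)² − (tr Σ)² − 2 tr(Σ²)`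
    let βx : ℝ := (∫ u, (∑ j, u j ^ 2) ^ 2 ∂με) - Sig.trace ^ 2 - 2 * (Sig ^ 2).trace
    -- `z_{i,1} − A₁₂A₂₂⁻¹z_{i,2}`
    let w : Fin n → (Fin q₁ → ℝ) :=
      fun i => (fun j => z i (Sum.inl j)) -
        (A.toBlocks₁₂ * (A.toBlocks₂₂)⁻¹).mulVec (fun j => z i (Sum.inr j))
    let βz1 : ℝ := ∑ i, (w i ⬝ᵥ (A112⁻¹ ^ 2).mulVec (w i)) ^ 2
    let βz2 : ℝ := ∑ i, (w i ⬝ᵥ A112⁻¹.mulVec (w i)) ^ 2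
    (∫ ω, M₁ ω ∂P = Sig.trace * (A112⁻¹).trace) ∧
    (∫ ω, M₂ ω ∂P = (q₁ : ℝ) * Sig.trace) ∧
    (variance M₁ P = 2 * (Sig ^ 2).trace * (A112⁻¹ ^ 2).trace + βx * βz1) ∧
    (variance M₂ P = 2 * (q₁ : ℝ) * (Sig ^ 2).trace + βx * βz2) := by
  intro x A Bhat Bhat₁ A112 M₁ M₂ βx w βz1 βz2
  let Z : Matrix (Fin n) (Fin q₁ ⊕ Fin q₂) ℝ := Matrix.of z
  let W : Matrix (Fin n) (Fin q₁) ℝ := Matrix.of w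
  let U : Ω → Matrix (Fin p) (Fin n) ℝ := fun ω => Matrix.of fun a i => ε i ω a
  have hA : A = Zᵀ * Z := by
    ext a b
    simp [A, Z, Matrix.sum_apply, vecMulVec_apply, Matrix.mul_apply]
  have hW : W = Z.submatrix id Sum.inl -
      Z.submatrix id Sum.inr * (A.toBlocks₁₂ * (A.toBlocks₂₂)⁻¹)ᵀ := by
    ext i j
    rw [Matrix.sub_apply, Matrix.mul_apply]
    simp only [W, w, Z, Matrix.of_apply, Pi.sub_apply, Matrix.mulVec, dotProduct,
      Matrix.submatrix_apply, Matrix.transpose_apply, id]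
    congr 1
    exact Finset.sum_congr rfl fun k _ => mul_comm _ _
  obtain ⟨hAd, hd, hS, hWW, hV⟩ := linalg Z hrank A hA A112 rfl W hW
  have hSi : A112⁻¹ᵀ = A112⁻¹ := by rw [transpose_nonsing_inv, hS]
  have hl : A112⁻¹ * A112 = 1 := Matrix.nonsing_inv_mul _ hd.isUnit
  have hr : A112 * A112⁻¹ = 1 := Matrix.mul_nonsing_inv _ hd.isUnit
  have hBh : ∀ ω, Bhat₁ ω - B₁star = U ω * (W * A112⁻¹) := by
    intro ω
    have h1 : ∑ i, vecMulVec (x i ω) (z i) = B * A + U ω * Z := by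
      rw [hA]
      have : ∑ i, vecMulVec (x i ω) (z i) = (B * Zᵀ + U ω) * Z := by
        ext a b
        rw [Matrix.sum_apply, Matrix.mul_apply]
        refine Finset.sum_congr rfl fun i _ => ?_
        simp [vecMulVec_apply, x, Z, U, Matrix.mul_apply, Matrix.mulVec, dotProduct]
      rw [this, Matrix.add_mul, Matrix.mul_assoc]
    have h2 : Bhat ω = B + U ω * (Z * A⁻¹) := by
      change (∑ i, vecMulVec (x i ω) (z i)) * A⁻¹ = _
      rw [h1, Matrix.add_mul, Matrix.mul_assoc, Matrix.mul_nonsing_inv _ hAd.isUnit,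
        Matrix.mul_one, Matrix.mul_assoc]
    rw [← hV]
    ext a j
    simp only [Bhat₁, h2]
    simp [Matrix.mul_apply, hnull]
  have q1 := quad hmeas hlaw hindep hmean hcov hmom4 (W * (A112⁻¹ * A112⁻¹) * Wᵀ)
    (by simp only [transpose_mul, transpose_transpose, hSi, Matrix.mul_assoc]) M₁ (by
      ext ω
      simp only [M₁, hBh]
      change _ = (U ω * (W * (A112⁻¹ * A112⁻¹) * Wᵀ) * (U ω)ᵀ).trace
      simp only [transpose_mul, hSi, Matrix.mul_assoc])
  have q2 := quad hmeas hlaw hindep hmean hcov hmom4 (W * A112⁻¹ * Wᵀ)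
    (by simp only [transpose_mul, transpose_transpose, hSi, Matrix.mul_assoc]) M₂ (by
      ext ω
      simp only [M₂, hBh]
      change _ = (U ω * (W * A112⁻¹ * Wᵀ) * (U ω)ᵀ).trace
      have : W * A112⁻¹ = W * A112⁻¹ * (A112 * A112⁻¹) := by rw [hr, Matrix.mul_one]
      conv_rhs => rw [this]
      simp only [transpose_mul, hSi, Matrix.mul_assoc])
  have ht : ∀ D : Matrix (Fin q₁) (Fin q₁) ℝ, (W * D * Wᵀ).trace = (A112 * D).trace := by
    intro D
    rw [Matrix.trace_mul_comm, ← Matrix.mul_assoc, hWW]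
  have ht2 : ∀ D : Matrix (Fin q₁) (Fin q₁) ℝ, (W * D * Wᵀ * (W * D * Wᵀ)).trace =
      (A112 * D * (A112 * D)).trace := by
    intro D
    have : W * D * Wᵀ * (W * D * Wᵀ) = W * (D * (A112 * D)) * Wᵀ := by
      rw [← hWW]; simp only [Matrix.mul_assoc]
    rw [this, ht, ← Matrix.mul_assoc]
  have hdg : ∀ (D : Matrix (Fin q₁) (Fin q₁) ℝ) i, (W * D * Wᵀ) i i = w i ⬝ᵥ D.mulVec (w i) := by
    intro D i
    rw [Matrix.mul_assoc, Matrix.mul_apply]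
    rfl
  have hrr : A112 * (A112⁻¹ * A112⁻¹) = A112⁻¹ := by rw [← Matrix.mul_assoc, hr, Matrix.one_mul]
  simp only [ht2, ht, hdg, hrr, hr, Matrix.mul_one, Matrix.trace_one, Fintype.card_fin] at q1 q2
  simp only [← pow_two A112⁻¹] at q1
  refine ⟨q1.1, ?_, q1.2, ?_⟩
  · rw [q2.1, mul_comm]
  · rw [q2.2]
    simp only [βx, βz2]
    ring
end
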